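/- arXiv:math/0101256 — 2 statements merged into one kernel-verified Lean document; each statement's English description precedes it below -/
import Mathlib

section
/- Fix g ≥ 2. In the polynomial ring ℚ[α, β, γ], define a sequence of polynomials c₀ = 1, c₁ = α, c₂ = α²/2, and for n ≥ 3, n·c_n = α·c_{n−1} + (n−2)·β·c_{n−2} + 2·γ·c_{n−3}. Let I_g be the ideal of ℚ[α, β, γ] generated by c_{g+1}, c_{g+2}, c_{g+3}, and let ξ = αβ + 2γ. Define rational numbers b_k = 2^{2k}·B_{2k}/(2k)!, where B_{2k} is the 2k-th Bernoulli number (so Σ_{k≥0} b_k t^{2k} is the Taylor series of t/tanh(t), e.g. b₀ = 1, b₁ = 1/3, b₂ = −2/45). Then for all natural numbers m, n with m + 2n = 3g − 3 and n < g − 1, the element (g−2)!·α^m·β^n + m!·b_{g−n−1}·α^{g−2}·β^{g−2}·ξ belongs to the ideal I_g. -/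
open MvPolynomial

/-- The sequence `c₀ = 1`, `c₁ = α`, `c₂ = α²/2`,
`n·c_n = α·c_{n−1} + (n−2)·β·c_{n−2} + 2·γ·c_{n−3}` for `n ≥ 3`, in `ℚ[α, β, γ]`
(with `α = X 0`, `β = X 1`, `γ = X 2`). -/
noncomputable def cseq : ℕ → MvPolynomial (Fin 3) ℚ
  | 0 => 1
  | 1 => X 0
  | 2 => C (1 / 2 : ℚ) * X 0 ^ 2
  | (n + 3) =>
      C (((n : ℚ) + 3)⁻¹) *
        (X 0 * cseq (n + 2) + C ((n : ℚ) + 1) * X 1 * cseq (n + 1) + 2 * X 2 * cseq n)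

/-- The ideal `I_k = (c_{k+1}, c_{k+2}, c_{k+3})` of `ℚ[α, β, γ]`. -/
noncomputable def cIdeal (k : ℕ) : Ideal (MvPolynomial (Fin 3) ℚ) :=
  Ideal.span {cseq (k + 1), cseq (k + 2), cseq (k + 3)}

/-- `ξ = αβ + 2γ`. -/
noncomputable def xiPoly : MvPolynomial (Fin 3) ℚ := X 0 * X 1 + 2 * X 2

/-- `b_k = 2^{2k} B_{2k} / (2k)!`, the Taylor coefficients of `t / tanh t`. -/
def bCoeff (k : ℕ) : ℚ := 2 ^ (2 * k) * bernoulli (2 * k) / (Nat.factorial (2 * k) : ℚ)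


/-! ### The recursion and the chain of ideals -/

theorem cseq_add_three (n : ℕ) :
    ((n : MvPolynomial (Fin 3) ℚ) + 3) * cseq (n + 3) =
      X 0 * cseq (n + 2) + ((n : MvPolynomial (Fin 3) ℚ) + 1) * X 1 * cseq (n + 1) +
        2 * X 2 * cseq n := by
  have h : ((n : MvPolynomial (Fin 3) ℚ) + 3) * C (((n : ℚ) + 3)⁻¹) = 1 := by
    have h3 : ((n : MvPolynomial (Fin 3) ℚ) + 3) = C ((n : ℚ) + 3) := by
      rw [C_add, map_natCast, map_ofNat]
    rw [h3, ← C_mul, mul_inv_cancel₀ (by positivity), C_1]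
  rw [cseq, ← mul_assoc, h]
  simp

theorem two_mul_cseq_two : 2 * cseq 2 = X 0 ^ 2 := by
  rw [cseq, ← mul_assoc, ← map_ofNat (C : ℚ →+* MvPolynomial (Fin 3) ℚ) 2, ← C_mul]
  norm_num

theorem Ideal.mem_of_natCast_mul_mem {I : Ideal (MvPolynomial (Fin 3) ℚ)} {k : ℕ} (hk : k ≠ 0)
    {f : MvPolynomial (Fin 3) ℚ} (h : (k : MvPolynomial (Fin 3) ℚ) * f ∈ I) : f ∈ I := by
  have h1 : C ((k : ℚ)⁻¹) * ((k : MvPolynomial (Fin 3) ℚ) * f) = f := by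
    rw [← mul_assoc, ← map_natCast (C : ℚ →+* MvPolynomial (Fin 3) ℚ) k, ← C_mul,
      inv_mul_cancel₀ (by exact_mod_cast hk), C_1, one_mul]
  exact h1 ▸ I.mul_mem_left _ h

theorem cseq_mem_cIdeal {g n : ℕ} (h : g + 1 ≤ n) : cseq n ∈ cIdeal g := by
  induction n using Nat.strong_induction_on with
  | _ n ih =>
    by_cases h4 : n ≤ g + 3
    · apply Ideal.subset_span
      obtain rfl | rfl | rfl : n = g + 1 ∨ n = g + 2 ∨ n = g + 3 := by omega
      all_goals simp
    · obtain ⟨k, rfl⟩ : ∃ k, n = k + 3 := ⟨n - 3, by omega⟩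
      refine Ideal.mem_of_natCast_mul_mem (k := k + 3) (by omega) ?_
      push_cast
      rw [cseq_add_three]
      exact add_mem (add_mem (Ideal.mul_mem_left _ _ (ih _ (by omega) (by omega)))
        (Ideal.mul_mem_left _ _ (ih _ (by omega) (by omega))))
        (Ideal.mul_mem_left _ _ (ih _ (by omega) (by omega)))

theorem cIdeal_le_of_forall {k : ℕ} {I : Ideal (MvPolynomial (Fin 3) ℚ)}
    (h : ∀ n, k + 1 ≤ n → cseq n ∈ I) : cIdeal k ≤ I := by
  rw [cIdeal, Ideal.span_le]
  rintro f (rfl | rfl | rfl)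
  exacts [h _ (by omega), h _ (by omega), h _ (by omega)]

theorem two_mul_X_two_mul_mem_cIdeal {g : ℕ} {f : MvPolynomial (Fin 3) ℚ} (hf : f ∈ cIdeal g) :
    2 * X 2 * f ∈ cIdeal (g + 1) := by
  refine Submodule.span_induction (p := fun f _ => 2 * X 2 * f ∈ cIdeal (g + 1)) ?_ ?_ ?_ ?_ hf
  · have key : ∀ n, g + 1 ≤ n → 2 * X 2 * cseq n ∈ cIdeal (g + 1) := by
      intro n hn
      have h1 : 2 * X 2 * cseq n = ((n : MvPolynomial (Fin 3) ℚ) + 3) * cseq (n + 3) -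
          X 0 * cseq (n + 2) - ((n : MvPolynomial (Fin 3) ℚ) + 1) * X 1 * cseq (n + 1) := by
        rw [cseq_add_three]; ring
      rw [h1]
      exact sub_mem (sub_mem (Ideal.mul_mem_left _ _ (cseq_mem_cIdeal (by omega)))
        (Ideal.mul_mem_left _ _ (cseq_mem_cIdeal (by omega))))
        (Ideal.mul_mem_left _ _ (cseq_mem_cIdeal (by omega)))
    rintro f (rfl | rfl | rfl)
    exacts [key _ (by omega), key _ (by omega), key _ (by omega)]
  · simp
  · intro f h _ _ hf hh
    rw [mul_add]
    exact add_mem hf hh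
  · intro a f _ hf
    rw [smul_eq_mul, mul_left_comm]
    exact Ideal.mul_mem_left _ _ hf

/-- The derivation `∂/∂α` at fixed `β` and `ξ`. -/
noncomputable def alphaDeriv :
    Derivation ℚ (MvPolynomial (Fin 3) ℚ) (MvPolynomial (Fin 3) ℚ) :=
  mkDerivation ℚ ![1, 0, -(C (1 / 2 : ℚ) * X 1)]

theorem alphaDeriv_X_zero : alphaDeriv (X 0) = 1 := by simp [alphaDeriv]

theorem alphaDeriv_X_one : alphaDeriv (X 1) = 0 := by simp [alphaDeriv]

theorem alphaDeriv_two_mul_X_two : alphaDeriv (2 * X 2) = -X 1 := by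
  have h2 : alphaDeriv (2 : MvPolynomial (Fin 3) ℚ) = 0 := Derivation.map_natCast _ 2
  have h : (2 : MvPolynomial (Fin 3) ℚ) * C (1 / 2 : ℚ) = 1 := by
    rw [← map_ofNat (C : ℚ →+* MvPolynomial (Fin 3) ℚ) 2, ← C_mul]
    norm_num
  rw [Derivation.leibniz, h2, smul_zero, add_zero, alphaDeriv, mkDerivation_X]
  simp only [Matrix.cons_val, smul_eq_mul]
  linear_combination -X 1 * h

theorem alphaDeriv_cseq_succ (n : ℕ) : alphaDeriv (cseq (n + 1)) = cseq n := by
  have hnat : ∀ k : ℕ, alphaDeriv (k : MvPolynomial (Fin 3) ℚ) = 0 :=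
    fun k => Derivation.map_natCast _ k
  have h2 : alphaDeriv (2 : MvPolynomial (Fin 3) ℚ) = 0 := hnat 2
  have h3 : alphaDeriv (3 : MvPolynomial (Fin 3) ℚ) = 0 := hnat 3
  have e0 : cseq 0 = 1 := by simp [cseq]
  have e1 : cseq 1 = X 0 := by simp [cseq]
  induction n using Nat.strong_induction_on with
  | _ n ih =>
    match n, ih with
    | 0, _ => rw [zero_add, e0, e1, alphaDeriv_X_zero]
    | 1, _ =>
      have h := congrArg alphaDeriv two_mul_cseq_two
      rw [Derivation.leibniz, h2, sq, Derivation.leibniz, alphaDeriv_X_zero] at h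
      simp only [smul_eq_mul] at h
      apply mul_left_cancel₀ (two_ne_zero (α := MvPolynomial (Fin 3) ℚ))
      rw [e1]
      linear_combination h
    | k + 2, ih =>
      have h := congrArg alphaDeriv (cseq_add_three k)
      rw [map_add, map_add, Derivation.leibniz _ (2 * X 2), alphaDeriv_two_mul_X_two] at h
      simp only [map_add, Derivation.leibniz, smul_eq_mul, hnat, h3, alphaDeriv_X_zero,
        alphaDeriv_X_one, Derivation.map_one_eq_zero, ih (k + 1) (by omega), ih k (by omega),
        mul_zero, add_zero, mul_one] at h
      have hk : ((k : MvPolynomial (Fin 3) ℚ) + 3) ≠ 0 := by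
        exact_mod_cast (Nat.cast_ne_zero.2 (by omega) :
          ((k + 3 : ℕ) : MvPolynomial (Fin 3) ℚ) ≠ 0)
      apply mul_left_cancel₀ hk
      rw [h]
      obtain _ | j := k
      · have h0 : alphaDeriv (cseq 0) = 0 := by rw [e0, Derivation.map_one_eq_zero]
        rw [h0, e0, zero_add, e1]
        push_cast
        linear_combination -two_mul_cseq_two
      · rw [ih j (by omega)]
        have hj := cseq_add_three j
        push_cast
        linear_combination -hj

/-- The operator `(g + 1) β + 2 γ ∂` maps `I_g` into `I_{g+1}`. -/
theorem add_alphaDeriv_mem_cIdeal {g : ℕ} {f : MvPolynomial (Fin 3) ℚ} (hf : f ∈ cIdeal g) :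
    ((g : MvPolynomial (Fin 3) ℚ) + 1) * X 1 * f + 2 * X 2 * alphaDeriv f ∈ cIdeal (g + 1) := by
  have hle : ∀ n, g + 1 ≤ n → ((g : MvPolynomial (Fin 3) ℚ) + 1) * X 1 * cseq n +
      2 * X 2 * alphaDeriv (cseq n) ∈ cIdeal (g + 1) := by
    intro n hn
    obtain ⟨n, rfl⟩ : ∃ k, n = k + 1 := ⟨n - 1, by omega⟩
    rw [alphaDeriv_cseq_succ]
    obtain rfl | hlt : n = g ∨ g + 1 ≤ n := by omega
    · obtain _ | k := n
      · have h : (((0 : ℕ) : MvPolynomial (Fin 3) ℚ) + 1) * X 1 * cseq (0 + 1) + 2 * X 2 * cseq 0 =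
            3 * cseq 3 - X 0 * cseq 2 := by
          have := cseq_add_three 0
          push_cast at this ⊢
          linear_combination -this
        rw [h]
        exact sub_mem (Ideal.mul_mem_left _ _ (cseq_mem_cIdeal (by omega)))
          (Ideal.mul_mem_left _ _ (cseq_mem_cIdeal (by omega)))
      · have h : (((k + 1 : ℕ) : MvPolynomial (Fin 3) ℚ) + 1) * X 1 *
            cseq (k + 1 + 1) + 2 * X 2 * cseq (k + 1) =
            ((k : MvPolynomial (Fin 3) ℚ) + 4) * cseq (k + 4) - X 0 * cseq (k + 3) := by
          have := cseq_add_three (k + 1)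
          push_cast at this ⊢
          linear_combination -this
        rw [h]
        exact sub_mem (Ideal.mul_mem_left _ _ (cseq_mem_cIdeal (by omega)))
          (Ideal.mul_mem_left _ _ (cseq_mem_cIdeal (by omega)))
    · exact add_mem (Ideal.mul_mem_left _ _ (cseq_mem_cIdeal (by omega)))
        (two_mul_X_two_mul_mem_cIdeal (cseq_mem_cIdeal hlt))
  refine Submodule.span_induction (p := fun f _ => ((g : MvPolynomial (Fin 3) ℚ) + 1) * X 1 * f +
    2 * X 2 * alphaDeriv f ∈ cIdeal (g + 1)) ?_ ?_ ?_ ?_ hf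
  · rintro f (rfl | rfl | rfl)
    exacts [hle _ (by omega), hle _ (by omega), hle _ (by omega)]
  · simp
  · intro f h _ _ hf hh
    rw [map_add]
    convert add_mem hf hh using 1
    ring
  · intro a f hfI hf
    rw [smul_eq_mul, Derivation.leibniz, smul_eq_mul, smul_eq_mul]
    convert add_mem (Ideal.mul_mem_left _ a hf)
      (Ideal.mul_mem_left _ (alphaDeriv a) (two_mul_X_two_mul_mem_cIdeal hfI)) using 1
    ring

/-! ### Elements of the ideals with few powers of `α` -/

/-- Elements `e s r` of degree `2 s + r`, lying in `I_g` as soon as `g < r + s`,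
with leading terms `α ^ r β ^ s`. -/
noncomputable def eseq : ℕ → ℕ → MvPolynomial (Fin 3) ℚ
  | 0, r => cseq r
  | _ + 1, 0 => 0
  | s + 1, r + 1 => ((r : MvPolynomial (Fin 3) ℚ) + 1 + (s : MvPolynomial (Fin 3) ℚ)) * X 1 *
      eseq s (r + 1) +
      2 * X 2 * eseq s r

theorem eseq_one_add (r : ℕ) :
    eseq 1 r + X 0 * cseq (r + 1) = ((r : MvPolynomial (Fin 3) ℚ) + 2) * cseq (r + 2) := by
  obtain _ | r := r
  · have h1 : cseq 1 = X 0 := by simp [cseq]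
    simp only [eseq, h1]
    push_cast
    linear_combination -two_mul_cseq_two
  · have h := cseq_add_three r
    simp only [eseq]
    push_cast
    linear_combination -h

theorem eseq_add_two (t r : ℕ) :
    ((r : MvPolynomial (Fin 3) ℚ) + (t : MvPolynomial (Fin 3) ℚ) + 2) *
        (eseq (t + 2) r + X 0 * eseq (t + 1) (r + 1)) =
      ((r : MvPolynomial (Fin 3) ℚ) + 1) * ((r : MvPolynomial (Fin 3) ℚ) + 2) *
        eseq (t + 1) (r + 2) -
      ((t : MvPolynomial (Fin 3) ℚ) + 1) * (t : MvPolynomial (Fin 3) ℚ) * (2 * X 2 * eseq t (r + 1)) := by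
  induction t generalizing r with
  | zero =>
    obtain _ | r := r
    · have h := eseq_one_add 0
      have e0 : cseq 0 = 1 := by simp [cseq]
      have e1 : cseq 1 = X 0 := by simp [cseq]
      simp only [eseq] at h ⊢
      push_cast at h ⊢
      linear_combination 2 * X 1 * h + 4 * X 2 * (X 0 * e0 - e1)
    · have h := eseq_one_add r
      have h' := eseq_one_add (r + 1)
      simp only [eseq] at h h' ⊢
      push_cast at h h' ⊢
      linear_combination (r + 3) * ((r + 2) * X 1 * h' + 2 * X 2 * h)
  | succ t ih =>
    obtain _ | r := r
    · have h := ih 0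
      have h0 : (t : MvPolynomial (Fin 3) ℚ) * eseq t 0 = 0 := by
        obtain _ | t := t <;> simp [eseq]
      simp only [eseq] at h ⊢
      push_cast at h ⊢
      linear_combination (t + 3) * X 1 * h + (12 + 4 * t) * X 2 ^ 2 * h0
    · have h := ih r
      have h' := ih (r + 1)
      have hk : ((r : MvPolynomial (Fin 3) ℚ) + t + 2) ≠ 0 := by
        exact_mod_cast (Nat.cast_ne_zero.2 (by omega) :
          ((r + t + 2 : ℕ) : MvPolynomial (Fin 3) ℚ) ≠ 0)
      apply mul_left_cancel₀ hk
      simp only [eseq] at h h' ⊢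
      push_cast at h h' ⊢
      linear_combination (r + t + 2) * (r + t + 4) * X 1 * h' + (r + t + 4) * (2 * X 2) * h

theorem cIdeal_anti {g h : ℕ} (hgh : g ≤ h) : cIdeal h ≤ cIdeal g :=
  cIdeal_le_of_forall fun _ hn => cseq_mem_cIdeal (by omega)

theorem X_zero_mem_cIdeal_zero : (X 0 : MvPolynomial (Fin 3) ℚ) ∈ cIdeal 0 := by
  have h : cseq 1 = X 0 := by simp [cseq]
  exact h ▸ cseq_mem_cIdeal (by omega)

theorem two_mul_X_two_mem_cIdeal_zero : (2 * X 2 : MvPolynomial (Fin 3) ℚ) ∈ cIdeal 0 := by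
  have h : (2 * X 2 : MvPolynomial (Fin 3) ℚ) = 3 * cseq 3 - X 0 * cseq 2 - X 1 * cseq 1 := by
    have h := cseq_add_three 0
    have e0 : cseq 0 = 1 := by simp [cseq]
    push_cast at h
    linear_combination -h - 2 * X 2 * e0
  rw [h]
  exact sub_mem (sub_mem (Ideal.mul_mem_left _ _ (cseq_mem_cIdeal (by omega)))
    (Ideal.mul_mem_left _ _ (cseq_mem_cIdeal (by omega))))
    (Ideal.mul_mem_left _ _ (cseq_mem_cIdeal (by omega)))

theorem xiPoly_mem_cIdeal_zero : xiPoly ∈ cIdeal 0 :=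
  add_mem (Ideal.mul_mem_right _ _ X_zero_mem_cIdeal_zero) two_mul_X_two_mem_cIdeal_zero

theorem eseq_mem_cIdeal {s g r : ℕ} (h : g + 1 ≤ r + s) : eseq s r ∈ cIdeal g := by
  induction s using Nat.strong_induction_on generalizing g r with
  | _ s ih =>
    match s, ih with
    | 0, _ => exact cseq_mem_cIdeal h
    | 1, _ =>
      rw [eq_sub_of_add_eq (eseq_one_add r)]
      exact sub_mem (Ideal.mul_mem_left _ _ (cseq_mem_cIdeal (by omega)))
        (Ideal.mul_mem_left _ _ (cseq_mem_cIdeal (by omega)))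
    | t + 2, ih =>
      have h2 : 2 * X 2 * eseq t (r + 1) ∈ cIdeal g := by
        obtain _ | g := g
        · exact Ideal.mul_mem_right _ _ two_mul_X_two_mem_cIdeal_zero
        · exact two_mul_X_two_mul_mem_cIdeal (ih t (by omega) (by omega))
      refine Ideal.mem_of_natCast_mul_mem (k := r + t + 2) (by omega) ?_
      have e : ((r + t + 2 : ℕ) : MvPolynomial (Fin 3) ℚ) * eseq (t + 2) r =
          (((r + 1) * (r + 2) : ℕ) : MvPolynomial (Fin 3) ℚ) * eseq (t + 1) (r + 2) -
            (((t + 1) * t : ℕ) : MvPolynomial (Fin 3) ℚ) * (2 * X 2 * eseq t (r + 1)) -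
            (((r + t + 2 : ℕ) : MvPolynomial (Fin 3) ℚ) * X 0) * eseq (t + 1) (r + 1) := by
        push_cast
        linear_combination eseq_add_two t r
      rw [e]
      exact sub_mem (sub_mem (Ideal.mul_mem_left _ _ (ih _ (by omega) (by omega)))
        (Ideal.mul_mem_left _ _ h2)) (Ideal.mul_mem_left _ _ (ih _ (by omega) (by omega)))

theorem eseq_succ_one (s : ℕ) :
    eseq (s + 1) 1 = ((s + 1).factorial : MvPolynomial (Fin 3) ℚ) * (X 1 ^ s * xiPoly) := by
  induction s with
  | zero =>
    have e0 : cseq 0 = 1 := by simp [cseq]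
    have e1 : cseq 1 = X 0 := by simp [cseq]
    simp only [eseq, e0, e1, xiPoly]
    simp
    ring
  | succ s ih =>
    have h : eseq (s + 1) 0 = 0 := by simp [eseq]
    rw [eseq, ih, h, Nat.factorial_succ (s + 1)]
    push_cast
    ring

theorem X_one_pow_mul_xiPoly_mem_cIdeal (s : ℕ) : X 1 ^ s * xiPoly ∈ cIdeal (s + 1) :=
  Ideal.mem_of_natCast_mul_mem (Nat.factorial_ne_zero _)
    (eseq_succ_one s ▸ eseq_mem_cIdeal (by omega))

theorem eseq_one_two : eseq 1 2 = X 0 * xiPoly := by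
  have e1 : cseq 1 = X 0 := by simp [cseq]
  simp only [eseq, e1, xiPoly]
  push_cast
  linear_combination X 1 * two_mul_cseq_two

theorem X_zero_mul_xiPoly_mem_cIdeal : X 0 * xiPoly ∈ cIdeal 2 :=
  eseq_one_two ▸ eseq_mem_cIdeal (by omega)

theorem two_mul_eseq_add_two_two (s : ℕ) :
    2 * eseq (s + 2) 2 = ((s + 2).factorial : MvPolynomial (Fin 3) ℚ) *
      (X 1 ^ s * xiPoly * (((s : MvPolynomial (Fin 3) ℚ) + 1) * xiPoly + 2 * (X 0 * X 1))) := by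
  have hxi : 2 * X 2 = xiPoly - X 0 * X 1 := by rw [xiPoly]; ring
  induction s with
  | zero =>
    rw [eseq, eseq_succ_one, eseq_one_two, hxi]
    simp
    ring
  | succ s ih =>
    rw [eseq, eseq_succ_one, hxi, mul_add, mul_left_comm, ih, Nat.factorial_succ (s + 2)]
    push_cast
    ring

theorem X_one_pow_mul_xiPoly_mul_mem_cIdeal (s : ℕ) :
    X 1 ^ s * xiPoly * (((s : MvPolynomial (Fin 3) ℚ) + 1) * xiPoly + 2 * (X 0 * X 1)) ∈
      cIdeal (s + 3) :=
  Ideal.mem_of_natCast_mul_mem (Nat.factorial_ne_zero _)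
    (two_mul_eseq_add_two_two s ▸ Ideal.mul_mem_left _ _ (eseq_mem_cIdeal (by omega)))

theorem X_one_pow_mul_xiPoly_pow_mem_cIdeal {g b p : ℕ} (h : g ≤ b + (p + 1)) :
    X 1 ^ b * xiPoly ^ (p + 1) ∈ cIdeal g := by
  induction p generalizing g b with
  | zero =>
    rw [zero_add, pow_one]
    exact cIdeal_anti h (X_one_pow_mul_xiPoly_mem_cIdeal b)
  | succ p ih =>
    have e : X 1 ^ b * xiPoly ^ (p + 1 + 1) =
        X 0 * (X 1 ^ (b + 1) * xiPoly ^ (p + 1)) + 2 * X 2 * (X 1 ^ b * xiPoly ^ (p + 1)) := by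
      rw [pow_succ xiPoly (p + 1)]
      nth_rw 2 [xiPoly]
      ring
    rw [e]
    refine add_mem (Ideal.mul_mem_left _ _ (ih (by omega))) ?_
    obtain _ | g := g
    · exact Ideal.mul_mem_left _ _ (ih (by omega))
    · exact two_mul_X_two_mul_mem_cIdeal (ih (by omega))

/-! ### Expansion of `c_n` in the monomials `α ^ a β ^ b ξ ^ p` -/

/-- The coefficients `ρ l p` in
`c_n = ∑ l p, ρ l p * α ^ (n - p - 2 l) / (n - p - 2 l)! * β ^ (l - p) * ξ ^ p`. -/
def rhoCoeff : ℕ → ℕ → ℚ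
  | 0, 0 => 1
  | 0, _ + 1 => 0
  | _ + 1, 0 => 0
  | l + 1, p + 1 =>
      (((p : ℚ) + 1 + 2 * l) * rhoCoeff l (p + 1) + rhoCoeff l p) / ((p : ℚ) + 2 * l + 3)

theorem rhoCoeff_eq_zero_of_lt {l p : ℕ} (h : l < p) : rhoCoeff l p = 0 := by
  induction l generalizing p with
  | zero =>
    obtain ⟨p, rfl⟩ : ∃ k, p = k + 1 := ⟨p - 1, by omega⟩
    rw [rhoCoeff]
  | succ l ih =>
    obtain ⟨p, rfl⟩ : ∃ k, p = k + 1 := ⟨p - 1, by omega⟩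
    rw [rhoCoeff, ih (by omega), ih (by omega)]
    simp

theorem rhoCoeff_succ_succ (l p : ℕ) :
    ((p : ℚ) + 2 * l + 3) * rhoCoeff (l + 1) (p + 1) =
      ((p : ℚ) + 1 + 2 * l) * rhoCoeff l (p + 1) + rhoCoeff l p := by
  rw [rhoCoeff, mul_div_cancel₀]
  positivity

/-- The monomial `ρ l p * β ^ (l - p) * ξ ^ p`. -/
noncomputable def rhoTerm (l p : ℕ) : MvPolynomial (Fin 3) ℚ :=
  C (rhoCoeff l p) * (X 1 ^ (l - p) * xiPoly ^ p)

theorem rhoTerm_zero_zero : rhoTerm 0 0 = 1 := by simp [rhoTerm, rhoCoeff]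

theorem rhoTerm_succ_zero (l : ℕ) : rhoTerm (l + 1) 0 = 0 := by simp [rhoTerm, rhoCoeff]

theorem rhoTerm_eq_zero_of_lt {l p : ℕ} (h : l < p) : rhoTerm l p = 0 := by
  simp [rhoTerm, rhoCoeff_eq_zero_of_lt h]

theorem rhoTerm_succ_succ (l p : ℕ) :
    ((p : MvPolynomial (Fin 3) ℚ) + 2 * (l : MvPolynomial (Fin 3) ℚ) + 3) *
        rhoTerm (l + 1) (p + 1) =
      ((p : MvPolynomial (Fin 3) ℚ) + 1 + 2 * (l : MvPolynomial (Fin 3) ℚ)) *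
        (X 1 * rhoTerm l (p + 1)) + xiPoly * rhoTerm l p := by
  have h := congrArg (C : ℚ →+* MvPolynomial (Fin 3) ℚ) (rhoCoeff_succ_succ l p)
  simp only [map_add, map_mul, map_natCast, map_ofNat, map_one] at h
  rcases lt_trichotomy l p with hlt | rfl | hlt
  · rw [rhoTerm_eq_zero_of_lt (show l + 1 < p + 1 by omega),
      rhoTerm_eq_zero_of_lt (show l < p + 1 by omega), rhoTerm_eq_zero_of_lt hlt]
    simp
  · rw [rhoTerm_eq_zero_of_lt (show l < l + 1 by omega)]
    rw [rhoCoeff_eq_zero_of_lt (show l < l + 1 by omega)] at h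
    simp only [rhoTerm, Nat.sub_self, map_zero] at h ⊢
    linear_combination xiPoly ^ (l + 1) * h
  · obtain ⟨k, rfl⟩ : ∃ k, l = p + 1 + k := ⟨l - p - 1, by omega⟩
    have e1 : p + 1 + k + 1 - (p + 1) = k + 1 := by omega
    have e2 : p + 1 + k - (p + 1) = k := by omega
    have e3 : p + 1 + k - p = k + 1 := by omega
    simp only [rhoTerm, e1, e2, e3]
    linear_combination X 1 ^ (k + 1) * xiPoly ^ (p + 1) * h

/-- The divided power `α ^ (n - q) / (n - q)!`, or zero when `n < q`. -/
noncomputable def dividedPow (n q : ℕ) : MvPolynomial (Fin 3) ℚ :=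
  if q ≤ n then C (((n - q).factorial : ℚ)⁻¹) * X 0 ^ (n - q) else 0

theorem dividedPow_add_right (n q k : ℕ) : dividedPow (n + k) (q + k) = dividedPow n q := by
  simp [dividedPow, Nat.add_sub_add_right]

theorem dividedPow_eq_zero_of_lt {n q : ℕ} (h : n < q) : dividedPow n q = 0 :=
  if_neg (by omega)

theorem succ_mul_dividedPow (n q : ℕ) :
    ((n : MvPolynomial (Fin 3) ℚ) + 1) * dividedPow (n + 1) q =
      X 0 * dividedPow n q + (q : MvPolynomial (Fin 3) ℚ) * dividedPow (n + 1) q := by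
  rcases lt_trichotomy q (n + 1) with h | rfl | h
  · obtain ⟨k, rfl⟩ : ∃ k, n = q + k := ⟨n - q, by omega⟩
    have e1 : q + k + 1 - q = k + 1 := by omega
    have e2 : q + k - q = k := by omega
    have hc : ((k : MvPolynomial (Fin 3) ℚ) + 1) * C (((k + 1).factorial : ℚ)⁻¹) =
        C ((k.factorial : ℚ)⁻¹) := by
      have h3 : ((k : MvPolynomial (Fin 3) ℚ) + 1) = C ((k : ℚ) + 1) := by
        rw [C_add, map_natCast, C_1]
      have h4 : (k.factorial : ℚ) ≠ 0 := by positivity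
      rw [h3, ← C_mul, Nat.factorial_succ]
      congr 1
      push_cast
      field_simp
    simp only [dividedPow, e1, e2, if_pos (show q ≤ q + k + 1 by omega),
      if_pos (show q ≤ q + k by omega)]
    push_cast
    linear_combination X 0 ^ (k + 1) * hc
  · rw [dividedPow_eq_zero_of_lt (show n < n + 1 by omega)]
    push_cast
    ring
  · rw [dividedPow_eq_zero_of_lt h, dividedPow_eq_zero_of_lt (show n < q by omega)]
    ring

/-- Partial sums of the expansion of `c_n`. -/
noncomputable def rhoSum (L n : ℕ) : MvPolynomial (Fin 3) ℚ :=
  ∑ l ∈ Finset.range (L + 1), ∑ p ∈ Finset.range (L + 1),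
    dividedPow n (p + 2 * l) * rhoTerm l p

/-- `rhoSum` with the weights `p + 2 l`. -/
noncomputable def weightedRhoSum (L n : ℕ) : MvPolynomial (Fin 3) ℚ :=
  ∑ l ∈ Finset.range (L + 1), ∑ p ∈ Finset.range (L + 1),
    ((p + 2 * l : ℕ) : MvPolynomial (Fin 3) ℚ) * (dividedPow n (p + 2 * l) * rhoTerm l p)

theorem succ_mul_rhoSum (L n : ℕ) :
    ((n : MvPolynomial (Fin 3) ℚ) + 1) * rhoSum L (n + 1) =
      X 0 * rhoSum L n + weightedRhoSum L (n + 1) := by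
  simp only [rhoSum, weightedRhoSum, Finset.mul_sum, ← Finset.sum_add_distrib]
  refine Finset.sum_congr rfl fun l _ => Finset.sum_congr rfl fun p _ => ?_
  linear_combination rhoTerm l p * succ_mul_dividedPow n (p + 2 * l)

/-- The weighted sum loses its first row and column after a shift. -/
theorem weightedRhoSum_eq (L n : ℕ) :
    weightedRhoSum L n = ∑ l ∈ Finset.range L, ∑ p ∈ Finset.range L,
      ((p + 2 * l + 3 : ℕ) : MvPolynomial (Fin 3) ℚ) *
        (dividedPow n (p + 2 * l + 3) * rhoTerm (l + 1) (p + 1)) := by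
  rw [weightedRhoSum, Finset.sum_range_succ']
  have h0 : ∑ p ∈ Finset.range (L + 1), ((p + 2 * 0 : ℕ) : MvPolynomial (Fin 3) ℚ) *
      (dividedPow n (p + 2 * 0) * rhoTerm 0 p) = 0 := by
    refine Finset.sum_eq_zero fun p _ => ?_
    obtain _ | p := p
    · simp
    · rw [rhoTerm_eq_zero_of_lt (by omega)]
      simp
  rw [h0, add_zero]
  refine Finset.sum_congr rfl fun l _ => ?_
  rw [Finset.sum_range_succ', rhoTerm_succ_zero, mul_zero, mul_zero, add_zero]
  refine Finset.sum_congr rfl fun p _ => ?_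
  rw [show p + 1 + 2 * (l + 1) = p + 2 * l + 3 by ring]

theorem weightedRhoSum_eq_sum_succ {L n : ℕ} (h : n < 2 * L) :
    weightedRhoSum L n = ∑ l ∈ Finset.range L, ∑ p ∈ Finset.range L,
      ((p + 1 + 2 * l : ℕ) : MvPolynomial (Fin 3) ℚ) *
        (dividedPow n (p + 1 + 2 * l) * rhoTerm l (p + 1)) := by
  rw [weightedRhoSum, Finset.sum_range_succ]
  have h0 : ∑ p ∈ Finset.range (L + 1), ((p + 2 * L : ℕ) : MvPolynomial (Fin 3) ℚ) *
      (dividedPow n (p + 2 * L) * rhoTerm L p) = 0 := by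
    refine Finset.sum_eq_zero fun p _ => ?_
    rw [dividedPow_eq_zero_of_lt (by omega)]
    simp
  rw [h0, add_zero]
  refine Finset.sum_congr rfl fun l _ => ?_
  rw [Finset.sum_range_succ', add_eq_left]
  obtain _ | l := l
  · simp
  · rw [rhoTerm_succ_zero, mul_zero, mul_zero]

theorem rhoSum_eq_sum_range {L n : ℕ} (h : n < 2 * L) :
    rhoSum L n = ∑ l ∈ Finset.range L, ∑ p ∈ Finset.range L,
      dividedPow n (p + 2 * l) * rhoTerm l p := by
  rw [rhoSum, Finset.sum_range_succ]
  have h0 : ∑ p ∈ Finset.range (L + 1), dividedPow n (p + 2 * L) * rhoTerm L p = 0 := by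
    refine Finset.sum_eq_zero fun p _ => ?_
    rw [dividedPow_eq_zero_of_lt (by omega), zero_mul]
  rw [h0, add_zero]
  refine Finset.sum_congr rfl fun l hl => ?_
  rw [Finset.sum_range_succ, rhoTerm_eq_zero_of_lt (Finset.mem_range.1 hl), mul_zero, add_zero]

theorem weightedRhoSum_add_three {L n : ℕ} (h : n + 1 < 2 * L) :
    weightedRhoSum L (n + 3) = X 1 * weightedRhoSum L (n + 1) + xiPoly * rhoSum L n := by
  rw [weightedRhoSum_eq, weightedRhoSum_eq_sum_succ h, rhoSum_eq_sum_range (by omega)]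
  simp only [Finset.mul_sum, ← Finset.sum_add_distrib]
  refine Finset.sum_congr rfl fun l _ => Finset.sum_congr rfl fun p _ => ?_
  have h1 : dividedPow (n + 1) (p + 1 + 2 * l) = dividedPow n (p + 2 * l) := by
    rw [← dividedPow_add_right n (p + 2 * l) 1]
    congr 1
    ring
  rw [h1, dividedPow_add_right]
  push_cast
  linear_combination dividedPow n (p + 2 * l) * rhoTerm_succ_succ l p

theorem rhoSum_zero (L : ℕ) : rhoSum L 0 = 1 := by
  rw [rhoSum, Finset.sum_eq_single 0, Finset.sum_eq_single 0]
  · simp [rhoTerm_zero_zero, dividedPow]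
  · intro p _ hp
    rw [rhoTerm_eq_zero_of_lt (by omega), mul_zero]
  · simp
  · intro l _ hl
    refine Finset.sum_eq_zero fun p _ => ?_
    rw [dividedPow_eq_zero_of_lt (by omega), zero_mul]
  · simp

theorem weightedRhoSum_eq_zero (L n : ℕ) (h : n < 3) : weightedRhoSum L n = 0 := by
  rw [weightedRhoSum_eq]
  refine Finset.sum_eq_zero fun l _ => Finset.sum_eq_zero fun p _ => ?_
  rw [dividedPow_eq_zero_of_lt (by omega)]
  simp

theorem cseq_eq_rhoSum {L n : ℕ} (h : n ≤ 2 * L) : cseq n = rhoSum L n := by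
  have e0 : cseq 0 = 1 := by simp [cseq]
  have e1 : cseq 1 = X 0 := by simp [cseq]
  induction n using Nat.strong_induction_on with
  | _ n ih =>
    match n, ih with
    | 0, _ => rw [e0, rhoSum_zero]
    | 1, _ =>
      have h1 := succ_mul_rhoSum L 0
      rw [weightedRhoSum_eq_zero L _ (by omega), rhoSum_zero] at h1
      push_cast at h1
      rw [e1]
      linear_combination -h1
    | 2, ih =>
      have h1 := succ_mul_rhoSum L 1
      rw [weightedRhoSum_eq_zero L _ (by omega), ← ih 1 (by omega) (by omega)] at h1
      push_cast at h1
      apply mul_left_cancel₀ (two_ne_zero (α := MvPolynomial (Fin 3) ℚ))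
      rw [e1] at h1
      linear_combination two_mul_cseq_two - h1
    | k + 3, ih =>
      have hk : ((k : MvPolynomial (Fin 3) ℚ) + 3) ≠ 0 := by
        exact_mod_cast (Nat.cast_ne_zero.2 (by omega) :
          ((k + 3 : ℕ) : MvPolynomial (Fin 3) ℚ) ≠ 0)
      apply mul_left_cancel₀ hk
      have h3 := succ_mul_rhoSum L (k + 2)
      have h1 := succ_mul_rhoSum L k
      rw [weightedRhoSum_add_three (by omega), ← ih (k + 2) (by omega) (by omega),
        ← ih k (by omega) (by omega)] at h3
      rw [← ih (k + 1) (by omega) (by omega), ← ih k (by omega) (by omega)] at h1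
      push_cast at h3
      rw [xiPoly] at h3
      linear_combination cseq_add_three k - h3 + X 1 * h1

theorem dividedPow_mul_rhoTerm_mem {J : Ideal (MvPolynomial (Fin 3) ℚ)} {n l p : ℕ}
    {f : MvPolynomial (Fin 3) ℚ}
    (h : (p = 0 → l = 0) → p ≤ l → p + 2 * l ≤ n →
      f * (X 0 ^ (n - (p + 2 * l)) * X 1 ^ (l - p) * xiPoly ^ p) ∈ J) :
    f * (dividedPow n (p + 2 * l) * rhoTerm l p) ∈ J := by
  by_cases h0 : p = 0 → l = 0
  swap
  · obtain ⟨rfl, hl⟩ := Classical.not_imp.1 h0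
    obtain ⟨k, rfl⟩ := Nat.exists_eq_succ_of_ne_zero hl
    rw [rhoTerm_succ_zero, mul_zero, mul_zero]
    exact J.zero_mem
  by_cases h1 : p ≤ l
  · by_cases h2 : p + 2 * l ≤ n
    · rw [dividedPow, if_pos h2, rhoTerm]
      convert J.mul_mem_left (C (((n - (p + 2 * l)).factorial : ℚ)⁻¹) * C (rhoCoeff l p))
        (h h0 h1 h2) using 1
      ring
    · rw [dividedPow_eq_zero_of_lt (by omega), zero_mul, mul_zero]
      exact J.zero_mem
  · rw [rhoTerm_eq_zero_of_lt (by omega), mul_zero, mul_zero]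
    exact J.zero_mem

theorem X_zero_pow_mem_of_cseq_mem {J : Ideal (MvPolynomial (Fin 3) ℚ)} {i n : ℕ}
    (hc : cseq n ∈ J)
    (h : ∀ a b p, a + 2 * b + 3 * (p + 1) = n →
      X 0 ^ i * (X 0 ^ a * X 1 ^ b * xiPoly ^ (p + 1)) ∈ J) :
    (X 0 ^ (i + n) : MvPolynomial (Fin 3) ℚ) ∈ J := by
  have hsum : cseq n = ∑ l ∈ Finset.range n, ∑ p ∈ Finset.range (n + 1),
      dividedPow n (p + 2 * (l + 1)) * rhoTerm (l + 1) p + dividedPow n 0 := by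
    rw [cseq_eq_rhoSum (show n ≤ 2 * n by omega), rhoSum, Finset.sum_range_succ']
    congr 1
    rw [Finset.sum_range_succ', rhoTerm_zero_zero, mul_one]
    convert zero_add _
    refine Finset.sum_eq_zero fun p _ => ?_
    rw [rhoTerm_eq_zero_of_lt (by omega), mul_zero]
  have hmem : X 0 ^ i * (∑ l ∈ Finset.range n, ∑ p ∈ Finset.range (n + 1),
      dividedPow n (p + 2 * (l + 1)) * rhoTerm (l + 1) p) ∈ J := by
    simp only [Finset.mul_sum]
    refine J.sum_mem fun l _ => J.sum_mem fun p _ => dividedPow_mul_rhoTerm_mem fun h0 h1 h2 => ?_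
    obtain _ | p := p
    · omega
    · exact h _ _ _ (by omega)
  have hfac : C (n.factorial : ℚ) * dividedPow n 0 = X 0 ^ n := by
    rw [dividedPow, if_pos (by omega), ← mul_assoc, ← C_mul, Nat.sub_zero,
      mul_inv_cancel₀ (by positivity), C_1, one_mul]
  have he : (X 0 ^ (i + n) : MvPolynomial (Fin 3) ℚ) = C (n.factorial : ℚ) *
      (X 0 ^ i * cseq n - X 0 ^ i * (∑ l ∈ Finset.range n, ∑ p ∈ Finset.range (n + 1),
        dividedPow n (p + 2 * (l + 1)) * rhoTerm (l + 1) p)) := by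
    rw [hsum, pow_add, ← hfac]
    ring
  rw [he]
  exact J.mul_mem_left _ (sub_mem (J.mul_mem_left _ hc) hmem)

/-! ### Vanishing of monomials of large weight -/

theorem alphaDeriv_X_zero_pow_mul_X_one_pow (m n : ℕ) :
    alphaDeriv (X 0 ^ (m + 1) * X 1 ^ n) =
      ((m : MvPolynomial (Fin 3) ℚ) + 1) * (X 0 ^ m * X 1 ^ n) := by
  rw [Derivation.leibniz, Derivation.leibniz_pow, Derivation.leibniz_pow, alphaDeriv_X_zero,
    alphaDeriv_X_one]
  simp
  ring

theorem monomial_mem_cIdeal (g : ℕ) :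
    (∀ m n, g + 1 ≤ m → 3 * g ≤ m + 2 * n + 2 →
      (X 0 ^ m * X 1 ^ n : MvPolynomial (Fin 3) ℚ) ∈ cIdeal g) ∧
    (∀ p m n, 3 * g ≤ m + 2 * n + 3 * (p + 1) + 2 →
      X 0 ^ m * X 1 ^ n * xiPoly ^ (p + 1) ∈ cIdeal g) := by
  induction g with
  | zero =>
    refine ⟨fun m n hm _ => ?_, fun p m n _ => ?_⟩
    · obtain ⟨m, rfl⟩ : ∃ k, m = k + 1 := ⟨m - 1, by omega⟩
      rw [pow_succ, mul_right_comm]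
      exact Ideal.mul_mem_left _ _ X_zero_mem_cIdeal_zero
    · rw [pow_succ xiPoly, ← mul_assoc]
      exact Ideal.mul_mem_left _ _ xiPoly_mem_cIdeal_zero
  | succ g ih =>
    obtain ⟨ih1, ih2⟩ := ih
    have t1 : ∀ m n, g + 2 ≤ m → 3 * g + 3 ≤ m + 2 * (n + 1) + 2 →
        (X 0 ^ m * X 1 ^ (n + 1) : MvPolynomial (Fin 3) ℚ) ∈ cIdeal (g + 1) := by
      intro m n hm hn
      obtain ⟨m, rfl⟩ : ∃ k, m = k + 1 := ⟨m - 1, by omega⟩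
      have h1 := add_alphaDeriv_mem_cIdeal (ih1 (m + 1) n (by omega) (by omega))
      have h2 := two_mul_X_two_mul_mem_cIdeal (ih1 m n (by omega) (by omega))
      rw [alphaDeriv_X_zero_pow_mul_X_one_pow] at h1
      refine Ideal.mem_of_natCast_mul_mem (k := g + 1) (by omega) ?_
      convert sub_mem h1 (Ideal.mul_mem_left _ ((m : MvPolynomial (Fin 3) ℚ) + 1) h2) using 1
      push_cast
      ring
    have t2 : ∀ m n, 3 * g + 3 ≤ m + 2 * n + 5 →
        X 0 ^ m * X 1 ^ n * xiPoly ∈ cIdeal (g + 1) := by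
      intro m n hmn
      rcases lt_trichotomy m g with hm | rfl | hm
      · obtain ⟨k, rfl⟩ : ∃ k, n = g + k := ⟨n - g, by omega⟩
        convert Ideal.mul_mem_left _ (X 0 ^ m * X 1 ^ k) (X_one_pow_mul_xiPoly_mem_cIdeal g) using 1
        ring
      · obtain ⟨k, rfl⟩ | h1 : (∃ k, n = m + k) ∨ n + 1 = m := by
          by_cases h : m ≤ n
          · exact Or.inl ⟨n - m, by omega⟩
          · exact Or.inr (by omega)
        · convert Ideal.mul_mem_left _ (X 0 ^ m * X 1 ^ k) (X_one_pow_mul_xiPoly_mem_cIdeal m)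
            using 1
          ring
        · subst h1
          obtain _ | n := n
          · convert X_zero_mul_xiPoly_mem_cIdeal using 1
            ring
          · have h1 := Ideal.mul_mem_left _ (X 0 ^ (n + 1)) (X_one_pow_mul_xiPoly_mul_mem_cIdeal n)
            have h2 := two_mul_X_two_mul_mem_cIdeal (ih2 0 (n + 1) n (by omega))
            refine Ideal.mem_of_natCast_mul_mem (k := n + 3) (by omega) ?_
            convert sub_mem h1 (Ideal.mul_mem_left _ ((n : MvPolynomial (Fin 3) ℚ) + 1) h2) using 1
            have hxi : 2 * X 2 = xiPoly - X 0 * X 1 := by rw [xiPoly]; ring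
            rw [hxi]
            push_cast
            ring
      · have h1 := t1 (m + 1) n (by omega) (by omega)
        have h2 := two_mul_X_two_mul_mem_cIdeal (ih1 m n (by omega) (by omega))
        convert add_mem h1 h2 using 1
        rw [xiPoly]
        ring
    have t2' : ∀ p m n, 3 * g + 3 ≤ m + 2 * n + 3 * (p + 1) + 2 →
        X 0 ^ m * X 1 ^ n * xiPoly ^ (p + 1) ∈ cIdeal (g + 1) := by
      intro p
      induction p with
      | zero =>
        intro m n hmn
        rw [zero_add, pow_one]
        exact t2 m n (by omega)
      | succ p ih =>
        intro m n hmn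
        have h1 := ih (m + 1) (n + 1) (by omega)
        have h2 := two_mul_X_two_mul_mem_cIdeal (ih2 p m n (by omega))
        convert add_mem h1 h2 using 1
        have hxi : 2 * X 2 = xiPoly - X 0 * X 1 := by rw [xiPoly]; ring
        rw [hxi]
        ring
    refine ⟨fun m n hm hmn => ?_, fun p m n hmn => t2' p m n (by omega)⟩
    obtain _ | n := n
    · obtain ⟨i, rfl⟩ : ∃ i, m = i + (g + 2) := ⟨m - (g + 2), by omega⟩
      rw [pow_zero, mul_one]
      refine X_zero_pow_mem_of_cseq_mem (cseq_mem_cIdeal (by omega)) fun a b p h => ?_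
      convert t2' p (i + a) b (by omega) using 1
      ring
    · exact t1 m n (by omega) (by omega)

/-- A relation among the elements of top weight. -/
theorem weight_relation_mem_cIdeal (b K p : ℕ) (hKp : 1 ≤ K + p) :
    X 0 ^ (b + 3 * K) * X 1 ^ b * xiPoly ^ p *
      (((b : MvPolynomial (Fin 3) ℚ) + 3 * (K : MvPolynomial (Fin 3) ℚ) + 1) * xiPoly +
        ((p : MvPolynomial (Fin 3) ℚ) + 1 - 2 * (K : MvPolynomial (Fin 3) ℚ)) * (X 0 * X 1)) ∈
      cIdeal (b + K + p + 2) := by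
  have hxi : 2 * X 2 = xiPoly - X 0 * X 1 := by rw [xiPoly]; ring
  have step : ∀ p, (∀ b, X 0 ^ (b + 3 * K) * X 1 ^ b * xiPoly ^ p *
      (((b : MvPolynomial (Fin 3) ℚ) + 3 * (K : MvPolynomial (Fin 3) ℚ) + 1) * xiPoly +
        ((p : MvPolynomial (Fin 3) ℚ) + 1 - 2 * (K : MvPolynomial (Fin 3) ℚ)) * (X 0 * X 1)) ∈
      cIdeal (b + K + p + 2)) → ∀ b, X 0 ^ (b + 3 * K) * X 1 ^ b * xiPoly ^ (p + 1) *
      (((b : MvPolynomial (Fin 3) ℚ) + 3 * (K : MvPolynomial (Fin 3) ℚ) + 1) * xiPoly +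
        (((p + 1 : ℕ) : MvPolynomial (Fin 3) ℚ) + 1 -
          2 * (K : MvPolynomial (Fin 3) ℚ)) * (X 0 * X 1)) ∈
      cIdeal (b + K + (p + 1) + 2) := by
    intro p ih b
    have h1 := two_mul_X_two_mul_mem_cIdeal (ih b)
    have h2 := ih (b + 1)
    rw [show b + 1 + K + p + 2 = b + K + (p + 1) + 2 by ring] at h2
    rw [show b + K + p + 2 + 1 = b + K + (p + 1) + 2 by ring] at h1
    convert add_mem h1 h2 using 1
    rw [hxi]
    push_cast
    ring
  obtain _ | K := K
  · obtain ⟨p, rfl⟩ : ∃ k, p = k + 1 := ⟨p - 1, by omega⟩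
    clear hKp
    induction p generalizing b with
    | zero =>
      convert Ideal.mul_mem_left _ (X 0 ^ b) (X_one_pow_mul_xiPoly_mul_mem_cIdeal b) using 1
      push_cast
      ring
    | succ p ih => exact step _ ih b
  · clear hKp
    induction p generalizing b with
    | zero =>
      have h := add_alphaDeriv_mem_cIdeal ((monomial_mem_cIdeal (b + (K + 1) + 1)).1
        (b + 3 * (K + 1) + 1) b (by omega) (by omega))
      rw [alphaDeriv_X_zero_pow_mul_X_one_pow, hxi] at h
      convert h using 1
      push_cast
      ring
    | succ p ih => exact step _ ih b

/-! ### The classes of top weight -/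

/-- The falling factorial `(2K - 1)(2K - 2) ⋯ (2K - p)`. -/
def fallingCoeff (K : ℕ) : ℕ → ℚ
  | 0 => 1
  | p + 1 => fallingCoeff K p * (2 * K - 1 - p)

/-- The normalized generators `α ^ (g - 1 + 2K) β ^ (g - 1 - K) / (g - 1 + 2K)!` in top weight,
with `- α ^ (g - 2) β ^ (g - 2) ξ / (g - 2)!` in place of the one for `K = 0`. -/
noncomputable def topElt (g K : ℕ) : MvPolynomial (Fin 3) ℚ :=
  if K = 0 then -(C (((g - 2).factorial : ℚ)⁻¹) * (X 0 ^ (g - 2) * X 1 ^ (g - 2) * xiPoly))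
  else C (((g - 1 + 2 * K).factorial : ℚ)⁻¹) * (X 0 ^ (g - 1 + 2 * K) * X 1 ^ (g - 1 - K))

theorem C_factorial_mul_C_inv (n : ℕ) :
    C (n.factorial : ℚ) * C ((n.factorial : ℚ)⁻¹) = (1 : MvPolynomial (Fin 3) ℚ) := by
  rw [← C_mul, mul_inv_cancel₀ (by positivity), C_1]

theorem sub_topElt_mem_cIdeal (b K p : ℕ) (h : K = 0 → p ≠ 0) :
    X 0 ^ (b + 3 * K) * X 1 ^ b * xiPoly ^ p -
      C (((b + 3 * K).factorial : ℚ) * fallingCoeff K p) * topElt (b + K + p + 1) K ∈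
        cIdeal (b + K + p + 1) := by
  have step : ∀ p, 1 ≤ K + p → (∀ b, X 0 ^ (b + 3 * K) * X 1 ^ b * xiPoly ^ p -
      C (((b + 3 * K).factorial : ℚ) * fallingCoeff K p) * topElt (b + K + p + 1) K ∈
        cIdeal (b + K + p + 1)) → ∀ b, X 0 ^ (b + 3 * K) * X 1 ^ b * xiPoly ^ (p + 1) -
      C (((b + 3 * K).factorial : ℚ) * fallingCoeff K (p + 1)) *
        topElt (b + K + (p + 1) + 1) K ∈ cIdeal (b + K + (p + 1) + 1) := by
    intro p hp ih b
    have h1 := weight_relation_mem_cIdeal b K p hp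
    have h2 := ih (b + 1)
    rw [show b + 1 + K + p + 1 = b + K + (p + 1) + 1 by ring,
      show b + 1 + 3 * K = b + 3 * K + 1 by ring] at h2
    rw [show b + K + p + 2 = b + K + (p + 1) + 1 by ring] at h1
    refine Ideal.mem_of_natCast_mul_mem (k := b + 3 * K + 1) (by omega) ?_
    convert sub_mem h1 (Ideal.mul_mem_left _ ((p : MvPolynomial (Fin 3) ℚ) + 1 -
      2 * (K : MvPolynomial (Fin 3) ℚ)) h2) using 1
    rw [fallingCoeff, Nat.factorial_succ]
    simp only [map_add, map_mul, map_sub, map_natCast, map_ofNat, map_one, Nat.cast_mul,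
      Nat.cast_add, Nat.cast_one, Nat.cast_ofNat]
    ring
  obtain _ | K := K
  · obtain ⟨p, rfl⟩ : ∃ k, p = k + 1 := ⟨p - 1, by have := h rfl; omega⟩
    clear h
    induction p generalizing b with
    | zero =>
      convert Ideal.zero_mem _
      have e : b + 0 + (0 + 1) + 1 - 2 = b := by omega
      simp only [topElt, if_pos, fallingCoeff, e]
      simp only [map_mul, map_sub, map_natCast, map_one, map_zero, Nat.cast_zero,
        mul_zero, add_zero]
      have h1 := C_factorial_mul_C_inv b
      rw [map_natCast] at h1
      linear_combination X 0 ^ b * X 1 ^ b * xiPoly * (-h1)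
    | succ p ih => exact step _ (by omega) ih b
  · clear h
    induction p generalizing b with
    | zero =>
      convert Ideal.zero_mem _
      have e1 : b + (K + 1) + 0 + 1 - 1 + 2 * (K + 1) = b + 3 * (K + 1) := by omega
      have e2 : b + (K + 1) + 0 + 1 - 1 - (K + 1) = b := by omega
      rw [topElt, if_neg (by omega), fallingCoeff, mul_one, e1, e2]
      linear_combination (-X 0 ^ (b + 3 * (K + 1)) * X 1 ^ b) *
        C_factorial_mul_C_inv (b + 3 * (K + 1))
    | succ p ih => exact step _ (by omega) ih b

theorem sum_topElt_mem_cIdeal {g J : ℕ} (hJ : 1 ≤ J) (hJg : J + 1 ≤ g) :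
    ∑ l ∈ Finset.range (J + 1),
      C (∑ p ∈ Finset.range (l + 1), rhoCoeff l p * fallingCoeff (J - l) p) * topElt g (J - l) ∈
        cIdeal g := by
  set N := g - 1 + 2 * J with hN
  have hc : X 1 ^ (g - 1 - J) * cseq N ∈ cIdeal g :=
    Ideal.mul_mem_left _ _ (cseq_mem_cIdeal (by omega))
  rw [cseq_eq_rhoSum (show N ≤ 2 * N by omega), rhoSum,
    ← Finset.sum_range_add_sum_Ico _ (show J + 1 ≤ N + 1 by omega), mul_add] at hc
  have htail : X 1 ^ (g - 1 - J) * ∑ l ∈ Finset.Ico (J + 1) (N + 1),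
      ∑ p ∈ Finset.range (N + 1), dividedPow N (p + 2 * l) * rhoTerm l p ∈ cIdeal g := by
    simp only [Finset.mul_sum]
    refine Ideal.sum_mem _ fun l hl => Ideal.sum_mem _ fun p _ =>
      dividedPow_mul_rhoTerm_mem fun h0 h1 _ => ?_
    rw [Finset.mem_Ico] at hl
    obtain ⟨p, rfl⟩ : ∃ k, p = k + 1 := ⟨p - 1, by omega⟩
    convert Ideal.mul_mem_left _ (X 0 ^ (N - (p + 1 + 2 * l)))
      (X_one_pow_mul_xiPoly_pow_mem_cIdeal
        (show g ≤ (g - 1 - J + (l - (p + 1))) + (p + 1) by omega)) using 1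
    ring
  have hhead := (Ideal.add_mem_iff_left _ htail).1 hc
  rw [← neg_mem_iff, ← Ideal.add_mem_iff_right _ hhead, ← sub_eq_add_neg]
  simp only [Finset.mul_sum]
  rw [← Finset.sum_sub_distrib]
  refine Ideal.sum_mem _ fun l hl => ?_
  rw [Finset.mem_range] at hl
  have hext : ∑ p ∈ Finset.range (l + 1), rhoCoeff l p * fallingCoeff (J - l) p =
      ∑ p ∈ Finset.range (N + 1), rhoCoeff l p * fallingCoeff (J - l) p := by
    refine Finset.sum_subset (fun p hp => ?_) fun p _ hp => ?_
    · rw [Finset.mem_range] at *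
      omega
    · rw [Finset.mem_range] at hp
      rw [rhoCoeff_eq_zero_of_lt (by omega), zero_mul]
  rw [hext, map_sum, Finset.sum_mul, ← Finset.sum_sub_distrib]
  refine Ideal.sum_mem _ fun p _ => ?_
  by_cases hp : l < p
  · rw [rhoTerm_eq_zero_of_lt hp, rhoCoeff_eq_zero_of_lt hp]
    simp
  by_cases h0 : J - l = 0 ∧ p = 0
  · obtain ⟨k, rfl⟩ : ∃ k, l = k + 1 := ⟨l - 1, by omega⟩
    rw [h0.2, rhoTerm_succ_zero, rhoCoeff]
    simp
  · obtain ⟨K, rfl⟩ : ∃ K, J = l + K := ⟨J - l, by omega⟩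
    obtain ⟨b, hb⟩ : ∃ b, g = b + K + p + 1 := ⟨g - (K + p + 1), by omega⟩
    have h1 := sub_topElt_mem_cIdeal b K p (by omega)
    rw [← hb] at h1
    have e1 : N - (p + 2 * l) = b + 3 * K := by omega
    have e2 : b = g - 1 - (l + K) + (l - p) := by omega
    have e3 : l + K - l = K := by omega
    convert Ideal.mul_mem_left _ (C (((b + 3 * K).factorial : ℚ)⁻¹) * C (rhoCoeff l p)) h1 using 1
    rw [dividedPow, if_pos (by omega), rhoTerm, e1, e3]
    have e4 : (X 1 ^ b : MvPolynomial (Fin 3) ℚ) =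
        X 1 ^ (g - 1 - (l + K)) * X 1 ^ (l - p) := by rw [← pow_add, ← e2]
    rw [e4]
    simp only [C_mul]
    linear_combination (C (rhoCoeff l p) * C (fallingCoeff K p) * topElt g K) *
      C_factorial_mul_C_inv (b + 3 * K)

theorem topElt_sub_mem_cIdeal {b : ℕ → ℚ} (hb0 : b 0 = 1)
    (hb : ∀ J, 1 ≤ J → ∑ l ∈ Finset.range (J + 1),
      (∑ p ∈ Finset.range (l + 1), rhoCoeff l p * fallingCoeff (J - l) p) * b (J - l) = 0)
    {g J : ℕ} (hJg : J + 1 ≤ g) : topElt g J - C (b J) * topElt g 0 ∈ cIdeal g := by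
  induction J using Nat.strong_induction_on with
  | _ J ih =>
    obtain rfl | hJ := Nat.eq_zero_or_pos J
    · rw [hb0, C_1, one_mul, sub_self]
      exact Ideal.zero_mem _
    have h1 := sum_topElt_mem_cIdeal hJ hJg
    have h2 := hb J hJ
    have ha : ∑ p ∈ Finset.range (0 + 1), rhoCoeff 0 p * fallingCoeff (J - 0) p = 1 := by
      simp [rhoCoeff, fallingCoeff]
    set a : ℕ → ℚ := fun l => ∑ p ∈ Finset.range (l + 1), rhoCoeff l p * fallingCoeff (J - l) p
    have hsum : ∑ l ∈ Finset.range (J + 1),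
        C (a l) * (topElt g (J - l) - C (b (J - l)) * topElt g 0) ∈ cIdeal g := by
      simp only [mul_sub, Finset.sum_sub_distrib, ← mul_assoc, ← C_mul, ← Finset.sum_mul,
        ← map_sum]
      rw [h2, C_0, zero_mul, sub_zero]
      exact h1
    rw [Finset.sum_range_succ', Ideal.add_mem_iff_right] at hsum
    · simpa only [show a 0 = 1 from ha, C_1, one_mul, Nat.sub_zero] using hsum
    · refine Ideal.sum_mem _ fun l hl => Ideal.mul_mem_left _ _ (ih _ ?_ ?_) <;>
        rw [Finset.mem_range] at hl <;> omega

theorem pairing_mem_of_coeff {b : ℕ → ℚ} (hb0 : b 0 = 1)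
    (hb : ∀ J, 1 ≤ J → ∑ l ∈ Finset.range (J + 1),
      (∑ p ∈ Finset.range (l + 1), rhoCoeff l p * fallingCoeff (J - l) p) * b (J - l) = 0)
    {g m n : ℕ} (hmn : m + 2 * n = 3 * g - 3) (hn : n < g - 1) :
    C ((g - 2).factorial : ℚ) * X 0 ^ m * X 1 ^ n +
      C ((m.factorial : ℚ) * b (g - n - 1)) * X 0 ^ (g - 2) * X 1 ^ (g - 2) * xiPoly ∈
        cIdeal g := by
  have h := topElt_sub_mem_cIdeal hb0 hb (show g - n - 1 + 1 ≤ g by omega)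
  have e1 : g - 1 + 2 * (g - n - 1) = m := by omega
  have e2 : g - 1 - (g - n - 1) = n := by omega
  rw [topElt, topElt, if_neg (by omega), if_pos rfl, e1, e2] at h
  convert Ideal.mul_mem_left _ (C (m.factorial : ℚ) * C ((g - 2).factorial : ℚ)) h using 1
  have h1 := C_factorial_mul_C_inv m
  have h2 := C_factorial_mul_C_inv (g - 2)
  rw [C_mul]
  linear_combination (-C ((g - 2).factorial : ℚ) * X 0 ^ m * X 1 ^ n) * h1 -
    (C (m.factorial : ℚ) * C (b (g - n - 1)) * X 0 ^ (g - 2) * X 1 ^ (g - 2) * xiPoly) * h2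

/-! ### The coefficients as Bernoulli numbers -/

/-- The Taylor series of `artanh t / t`. -/
noncomputable def artanhSeries : PowerSeries ℚ :=
  PowerSeries.mk fun n => if Even n then ((n : ℚ) + 1)⁻¹ else 0

theorem constantCoeff_artanhSeries : PowerSeries.constantCoeff artanhSeries = 1 := by
  rw [← PowerSeries.coeff_zero_eq_constantCoeff_apply, artanhSeries, PowerSeries.coeff_mk]
  simp

theorem artanhSeries_ode :
    (1 - PowerSeries.X ^ 2) *
      (artanhSeries + PowerSeries.X * PowerSeries.derivative ℚ artanhSeries) = 1 := by
  have h : artanhSeries + PowerSeries.X * PowerSeries.derivative ℚ artanhSeries =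
      PowerSeries.mk fun n => if Even n then 1 else 0 := by
    ext n
    obtain _ | n := n
    · simp [artanhSeries]
    · rw [map_add, PowerSeries.coeff_succ_X_mul, PowerSeries.coeff_derivative, artanhSeries,
        PowerSeries.coeff_mk, PowerSeries.coeff_mk]
      split_ifs
      · push_cast
        field_simp
        ring
      · simp
  rw [h]
  ext n
  rw [sub_mul, one_mul, map_sub, PowerSeries.coeff_X_pow_mul', PowerSeries.coeff_mk,
    PowerSeries.coeff_one]
  match n with
  | 0 => simp
  | 1 => simp
  | n + 2 => simp [Nat.even_add]

theorem artanhSeries_mul_inv : artanhSeries * artanhSeries⁻¹ = 1 :=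
  PowerSeries.mul_inv_cancel _ (by rw [constantCoeff_artanhSeries]; exact one_ne_zero)

theorem X_sq_dvd_artanhSeries_sub_one : PowerSeries.X ^ 2 ∣ artanhSeries - 1 := by
  rw [PowerSeries.X_pow_dvd_iff]
  intro m hm
  rw [map_sub, artanhSeries, PowerSeries.coeff_mk, PowerSeries.coeff_one]
  obtain rfl | rfl : m = 0 ∨ m = 1 := by omega
  all_goals simp

theorem coeff_artanhSeries_sub_one_pow (l p : ℕ) :
    PowerSeries.coeff (2 * l) ((artanhSeries - 1) ^ p) = p.factorial * rhoCoeff l p := by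
  induction l generalizing p with
  | zero =>
    obtain _ | p := p
    · simp [rhoCoeff]
    · simp [rhoCoeff, constantCoeff_artanhSeries]
  | succ l ih =>
    obtain _ | p := p
    · rw [pow_zero, PowerSeries.coeff_one, if_neg (by omega), rhoCoeff, mul_zero]
    · set W := artanhSeries - 1 with hW
      have hode : (1 - PowerSeries.X ^ 2) *
          (((p + 1 : ℕ) : PowerSeries ℚ) * W ^ (p + 1) +
            PowerSeries.X * PowerSeries.derivative ℚ (W ^ (p + 1))) =
          PowerSeries.X ^ 2 * (((p + 1 : ℕ) : PowerSeries ℚ) * W ^ p) := by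
        have hA : artanhSeries = W + 1 := by rw [hW]; ring
        have h := artanhSeries_ode
        rw [hA, map_add, PowerSeries.derivative_one, add_zero] at h
        rw [PowerSeries.derivative_pow, Nat.add_sub_cancel]
        linear_combination ((p + 1 : ℕ) : PowerSeries ℚ) * W ^ p * h
      have hc := congrArg (PowerSeries.coeff (2 * l + 2)) hode
      have hcoeff : ∀ n, PowerSeries.coeff n (((p + 1 : ℕ) : PowerSeries ℚ) * W ^ (p + 1) +
            PowerSeries.X * PowerSeries.derivative ℚ (W ^ (p + 1))) =
          ((p : ℚ) + 1 + n) * PowerSeries.coeff n (W ^ (p + 1)) := by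
        intro n
        rw [← nsmul_eq_mul, map_add, map_nsmul, nsmul_eq_mul]
        obtain _ | n := n
        · simp
        · rw [PowerSeries.coeff_succ_X_mul, PowerSeries.coeff_derivative]
          push_cast
          ring
      rw [sub_mul, one_mul, map_sub, PowerSeries.coeff_X_pow_mul, PowerSeries.coeff_X_pow_mul,
        hcoeff, hcoeff, ← nsmul_eq_mul, map_nsmul, nsmul_eq_mul, ih, ih] at hc
      have hr := rhoCoeff_succ_succ l p
      have hne : (p : ℚ) + 2 * l + 3 ≠ 0 := by positivity
      apply mul_left_cancel₀ hne
      rw [show 2 * (l + 1) = 2 * l + 2 by ring]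
      rw [Nat.factorial_succ] at hc ⊢
      push_cast at hc ⊢
      linear_combination hc - ((p : ℚ) + 1) * p.factorial * hr

theorem fallingCoeff_zero_left (p : ℕ) : fallingCoeff 0 p = (-1) ^ p * p.factorial := by
  induction p with
  | zero => simp [fallingCoeff]
  | succ p ih =>
    rw [fallingCoeff, ih, Nat.factorial_succ]
    push_cast
    ring

theorem fallingCoeff_succ_left (K p : ℕ) :
    fallingCoeff (K + 1) p = (p.factorial : ℚ) * ((2 * K + 1).choose p : ℚ) := by
  rw [← Nat.cast_mul, ← Nat.descFactorial_eq_factorial_mul_choose]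
  induction p with
  | zero => simp [fallingCoeff]
  | succ p ih =>
    rw [fallingCoeff, ih, Nat.descFactorial_succ]
    rcases le_or_gt p (2 * K + 1) with h | h
    · push_cast [Nat.cast_sub h]
      ring
    · rw [Nat.descFactorial_of_lt h]
      simp

theorem sum_rhoCoeff_mul_fallingCoeff (l K : ℕ) :
    ∑ p ∈ Finset.range (l + 1), rhoCoeff l p * fallingCoeff K p =
      PowerSeries.coeff (2 * l) (artanhSeries ^ (2 * K) * artanhSeries⁻¹) := by
  obtain _ | K := K
  · have hinv : artanhSeries ^ (2 * 0) * artanhSeries⁻¹ =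
        ∑ p ∈ Finset.range (l + 1), (-(artanhSeries - 1)) ^ p +
          (artanhSeries - 1) ^ (l + 1) * ((-1) ^ (l + 1) * artanhSeries⁻¹) := by
      have h := mul_neg_geom_sum (-(artanhSeries - 1)) (l + 1)
      rw [neg_pow (artanhSeries - 1) (l + 1)] at h
      linear_combination -artanhSeries⁻¹ * h +
        (∑ p ∈ Finset.range (l + 1), (-(artanhSeries - 1)) ^ p) * artanhSeries_mul_inv
    have hdvd : PowerSeries.X ^ (2 * (l + 1)) ∣
        (artanhSeries - 1) ^ (l + 1) * ((-1) ^ (l + 1) * artanhSeries⁻¹) := by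
      rw [pow_mul]
      exact (pow_dvd_pow_of_dvd X_sq_dvd_artanhSeries_sub_one _).mul_right _
    rw [hinv, map_add, PowerSeries.X_pow_dvd_iff.1 hdvd _ (by omega), add_zero, map_sum]
    refine Finset.sum_congr rfl fun p _ => ?_
    have hneg : (-(artanhSeries - 1)) ^ p =
        PowerSeries.C ((-1 : ℚ) ^ p) * (artanhSeries - 1) ^ p := by
      rw [neg_pow]
      simp
    rw [hneg, PowerSeries.coeff_C_mul, coeff_artanhSeries_sub_one_pow, fallingCoeff_zero_left]
    ring
  · have hpow : artanhSeries ^ (2 * (K + 1)) * artanhSeries⁻¹ =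
        ∑ p ∈ Finset.range (2 * K + 2),
          PowerSeries.C ((2 * K + 1).choose p : ℚ) * (artanhSeries - 1) ^ p := by
      have h := add_pow (artanhSeries - 1) 1 (2 * K + 1)
      rw [sub_add_cancel] at h
      rw [show 2 * (K + 1) = 2 * K + 1 + 1 by ring, pow_succ, mul_assoc, artanhSeries_mul_inv,
        mul_one, h]
      refine Finset.sum_congr rfl fun p _ => ?_
      rw [one_pow, mul_one, map_natCast, mul_comm]
    have hsub : ∀ M N : ℕ, M ≤ N → (∀ p, M ≤ p → rhoCoeff l p * fallingCoeff (K + 1) p = 0) →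
        ∑ p ∈ Finset.range M, rhoCoeff l p * fallingCoeff (K + 1) p =
          ∑ p ∈ Finset.range N, rhoCoeff l p * fallingCoeff (K + 1) p := by
      intro M N hMN h
      exact Finset.sum_subset (Finset.range_subset_range.2 hMN) fun p _ hp =>
        h p (by simpa using hp)
    rw [hpow, map_sum, hsub (l + 1) (l + 1 + (2 * K + 2)) (by omega) fun p hp => by
        rw [rhoCoeff_eq_zero_of_lt (by omega), zero_mul],
      ← hsub (2 * K + 2) (l + 1 + (2 * K + 2)) (by omega) fun p hp => by
        rw [fallingCoeff_succ_left, Nat.choose_eq_zero_of_lt (by omega)]; simp]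
    refine Finset.sum_congr rfl fun p _ => ?_
    rw [PowerSeries.coeff_C_mul, coeff_artanhSeries_sub_one_pow, fallingCoeff_succ_left]
    ring

theorem bernoulliPowerSeries_ode :
    PowerSeries.X * PowerSeries.derivative ℚ (bernoulliPowerSeries ℚ) =
      bernoulliPowerSeries ℚ - bernoulliPowerSeries ℚ ^ 2 -
        PowerSeries.X * bernoulliPowerSeries ℚ := by
  have h := bernoulliPowerSeries_mul_exp_sub_one ℚ
  have hd := congrArg (PowerSeries.derivative ℚ) h
  rw [Derivation.leibniz, map_sub, PowerSeries.derivative_exp, PowerSeries.derivative_one,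
    PowerSeries.derivative_X, smul_eq_mul, smul_eq_mul] at hd
  linear_combination bernoulliPowerSeries ℚ * hd -
    (bernoulliPowerSeries ℚ + PowerSeries.derivative ℚ (bernoulliPowerSeries ℚ)) * h

theorem eq_zero_of_ode {E F H : PowerSeries ℚ} (hF : PowerSeries.constantCoeff F = 1)
    (hH : PowerSeries.constantCoeff H = -1)
    (h : F * (PowerSeries.X * PowerSeries.derivative ℚ E) = E * H) : E = 0 := by
  by_contra hE
  obtain ⟨n, E', hn, hE'⟩ : ∃ n E', E = PowerSeries.X ^ n * E' ∧
      PowerSeries.constantCoeff E' ≠ 0 := by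
    obtain ⟨E', hE'⟩ := PowerSeries.X_pow_order_dvd (φ := E)
    refine ⟨_, E', hE', fun h0 => PowerSeries.coeff_order hE ?_⟩
    nth_rw 2 [hE']
    rw [PowerSeries.coeff_X_pow_mul', if_pos le_rfl, Nat.sub_self,
      PowerSeries.coeff_zero_eq_constantCoeff_apply, h0]
  have hX : PowerSeries.X * PowerSeries.derivative ℚ E =
      PowerSeries.X ^ n * ((n : PowerSeries ℚ) * E' +
        PowerSeries.X * PowerSeries.derivative ℚ E') := by
    rw [hn, Derivation.leibniz, PowerSeries.derivative_pow, PowerSeries.derivative_X, smul_eq_mul,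
      smul_eq_mul]
    obtain _ | n := n
    · simp
    · rw [Nat.add_sub_cancel]
      ring
  rw [hX, hn, mul_left_comm, mul_assoc] at h
  have h1 := congrArg PowerSeries.constantCoeff
    (mul_left_cancel₀ (pow_ne_zero n PowerSeries.X_ne_zero) h)
  simp only [map_mul, map_add, map_natCast, hF, hH, PowerSeries.constantCoeff_X] at h1
  have h2 : ((n : ℚ) + 1) * PowerSeries.constantCoeff E' = 0 := by linear_combination h1
  exact (mul_ne_zero (by positivity) hE') h2

theorem hasSubst_X_mul_artanhSeries :
    PowerSeries.HasSubst (2 * (PowerSeries.X * artanhSeries)) :=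
  PowerSeries.HasSubst.of_constantCoeff_zero' (by simp)

theorem exists_subst_eq_sum_add {v : PowerSeries ℚ} (hv : PowerSeries.HasSubst v)
    (f : PowerSeries ℚ) (N : ℕ) :
    ∃ R, f.subst v =
      ∑ i ∈ Finset.range N, PowerSeries.C (PowerSeries.coeff i f) * v ^ i + v ^ N * R := by
  have h := congrArg (PowerSeries.substAlgHom hv) (PowerSeries.eq_X_pow_mul_shift_add_trunc N f)
  rw [map_add, map_mul, map_pow, PowerSeries.coe_substAlgHom, PowerSeries.subst_X hv,
    PowerSeries.subst_coe hv, Polynomial.aeval_def, PowerSeries.eval₂_trunc_eq_sum_range,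
    add_comm] at h
  exact ⟨_, h⟩

theorem bernoulliPowerSeries_subst :
    (bernoulliPowerSeries ℚ).subst (2 * (PowerSeries.X * artanhSeries)) =
      artanhSeries * (1 - PowerSeries.X) := by
  have hv := hasSubst_X_mul_artanhSeries
  set v : PowerSeries ℚ := 2 * (PowerSeries.X * artanhSeries) with hv_def
  set Y : PowerSeries ℚ := (bernoulliPowerSeries ℚ).subst v with hY
  have hchain := PowerSeries.derivative_subst (f := bernoulliPowerSeries ℚ) hv
  have hsub := congrArg (PowerSeries.substAlgHom hv) bernoulliPowerSeries_ode
  simp only [map_sub, map_mul, map_pow, PowerSeries.coe_substAlgHom, PowerSeries.subst_X hv,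
    ← hY] at hsub
  rw [← hY] at hchain
  have hv0 : PowerSeries.constantCoeff v = 0 := by simp [hv_def]
  have hY0 : PowerSeries.constantCoeff Y = 1 := by
    obtain ⟨R, hR⟩ := exists_subst_eq_sum_add hv (bernoulliPowerSeries ℚ) 1
    rw [hY, hR]
    simp [hv0, bernoulliPowerSeries]
  have hdv : PowerSeries.derivative ℚ v =
      2 * (artanhSeries + PowerSeries.X * PowerSeries.derivative ℚ artanhSeries) := by
    have h2 : PowerSeries.derivative ℚ (2 : PowerSeries ℚ) = 0 := Derivation.map_natCast _ 2
    rw [hv_def, Derivation.leibniz, h2, Derivation.leibniz, PowerSeries.derivative_X]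
    simp only [smul_eq_mul]
    ring
  rw [← sub_eq_zero]
  refine eq_zero_of_ode (F := artanhSeries * (1 - PowerSeries.X ^ 2))
    (H := 1 - Y - artanhSeries * (1 - PowerSeries.X) - v) ?_ ?_ ?_
  · simp [constantCoeff_artanhSeries]
  · simp [constantCoeff_artanhSeries, hY0, hv0]
  · rw [map_sub, hchain, hdv, Derivation.leibniz, map_sub, PowerSeries.derivative_one,
      PowerSeries.derivative_X]
    simp only [smul_eq_mul]
    have hode := artanhSeries_ode
    rw [hv_def] at hsub ⊢
    linear_combination (2 * PowerSeries.X * artanhSeries *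
      (PowerSeries.derivative ℚ (bernoulliPowerSeries ℚ)).subst v) * hode + hsub -
      artanhSeries * (1 - PowerSeries.X) * hode

theorem sum_range_eq_sum_even {f : ℕ → ℚ} (hf : ∀ k, f (2 * k + 1) = 0) (J : ℕ) :
    ∑ n ∈ Finset.range (2 * J + 1), f n = ∑ k ∈ Finset.range (J + 1), f (2 * k) := by
  induction J with
  | zero => simp
  | succ J ih =>
    rw [show 2 * (J + 1) + 1 = 2 * J + 1 + 1 + 1 by ring, Finset.sum_range_succ,
      Finset.sum_range_succ, hf, add_zero, ih, Finset.sum_range_succ _ (J + 1)]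
    congr 2

theorem sum_rhoCoeff_mul_bCoeff {J : ℕ} (hJ : 1 ≤ J) :
    ∑ l ∈ Finset.range (J + 1),
      (∑ p ∈ Finset.range (l + 1), rhoCoeff l p * fallingCoeff (J - l) p) * bCoeff (J - l) =
        0 := by
  obtain ⟨R, hR⟩ := exists_subst_eq_sum_add hasSubst_X_mul_artanhSeries (bernoulliPowerSeries ℚ)
    (2 * J + 1)
  have hmul : 1 - PowerSeries.X = ∑ n ∈ Finset.range (2 * J + 1),
      PowerSeries.C (2 ^ n * bernoulli n / n.factorial) *
        (PowerSeries.X ^ n * (artanhSeries ^ n * artanhSeries⁻¹)) +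
      PowerSeries.X ^ (2 * J + 1) *
        ((2 * artanhSeries) ^ (2 * J + 1) * R * artanhSeries⁻¹) := by
    have hcoeff : ∑ n ∈ Finset.range (2 * J + 1),
        PowerSeries.C (2 ^ n * bernoulli n / n.factorial) *
          (PowerSeries.X ^ n * (artanhSeries ^ n * artanhSeries⁻¹)) =
        (∑ n ∈ Finset.range (2 * J + 1),
          PowerSeries.C (PowerSeries.coeff n (bernoulliPowerSeries ℚ)) *
            (2 * (PowerSeries.X * artanhSeries)) ^ n) * artanhSeries⁻¹ := by
      rw [Finset.sum_mul]
      refine Finset.sum_congr rfl fun n _ => ?_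
      rw [bernoulliPowerSeries, PowerSeries.coeff_mk, mul_pow, mul_pow, mul_div_assoc,
        map_mul, map_pow, map_ofNat, Algebra.algebraMap_self_apply]
      ring
    rw [bernoulliPowerSeries_subst] at hR
    rw [hcoeff]
    have h := artanhSeries_mul_inv
    linear_combination artanhSeries⁻¹ * hR - (1 - PowerSeries.X) * h
  have hc := congrArg (PowerSeries.coeff (2 * J)) hmul
  have hleft : PowerSeries.coeff (2 * J) (1 - PowerSeries.X : PowerSeries ℚ) = 0 := by
    rw [map_sub, PowerSeries.coeff_one, PowerSeries.coeff_X, if_neg (by omega),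
      if_neg (by omega), sub_zero]
  rw [hleft, map_add, PowerSeries.coeff_X_pow_mul', if_neg (by omega), add_zero, map_sum,
    sum_range_eq_sum_even, ← Finset.sum_range_reflect] at hc
  · rw [hc]
    refine Finset.sum_congr rfl fun l hl => ?_
    rw [Finset.mem_range] at hl
    rw [sum_rhoCoeff_mul_fallingCoeff, PowerSeries.coeff_C_mul, PowerSeries.coeff_X_pow_mul',
      if_pos (by omega), bCoeff, show J + 1 - 1 - l = J - l by omega,
      show 2 * J - 2 * (J - l) = 2 * l by omega, mul_comm]
  · intro k
    rw [PowerSeries.coeff_C_mul]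
    obtain _ | k := k
    · simp only [mul_zero, zero_add, pow_one]
      rw [artanhSeries_mul_inv, mul_one, PowerSeries.coeff_X, if_neg (by omega), mul_zero]
    · rw [bernoulli_eq_zero_of_odd ⟨k + 1, rfl⟩ (by omega)]
      simp

theorem bCoeff_zero : bCoeff 0 = 1 := by simp [bCoeff]

/-- The intersection pairing relation: for `g ≥ 2` and natural numbers `m, n` with
`m + 2n = 3g − 3` and `n < g − 1`, one has
`(g−2)!·α^m β^n + m!·b_{g−n−1}·α^{g−2} β^{g−2} ξ ∈ I_g` in `ℚ[α, β, γ]`. -/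
theorem pairing_relation_mem_cIdeal (g : ℕ) (hg : 2 ≤ g) (m n : ℕ)
    (hmn : m + 2 * n = 3 * g - 3) (hn : n < g - 1) :
    C ((Nat.factorial (g - 2) : ℚ)) * X 0 ^ m * X 1 ^ n +
      C ((Nat.factorial m : ℚ) * bCoeff (g - n - 1)) * X 0 ^ (g - 2) * X 1 ^ (g - 2) * xiPoly
      ∈ cIdeal g :=
  pairing_mem_of_coeff bCoeff_zero (fun _ hJ => sum_rhoCoeff_mul_bCoeff hJ) hmn hn
end

section
/- Fix g ≥ 2 and let A = ⋀(ℂ^{2g}) ⊗_ℂ ℂ[u] be the tensor product of the exterior algebra on the standard basis vectors d₁,…,d_{2g} of ℂ^{2g} with a polynomial ring in one central variable u. Let σ be the ℂ-algebra automorphism of A determined by σ(d_i) = −d_i for all i and σ(u) = −u, let B be the ℂ-subalgebra of A generated by the elements w = Σ_{i=1}^{g} d_i d_{g+i}, u², and u·d_i for i = 1,…,2g, and let D = A·u^{g−1} = {x ∈ A : x = y·u^{g−1} for some y ∈ A}. Then B ∩ D = {x ∈ D : σ(x) = x}; that is, an element of A divisible by u^{g−1} lies in B if and only if it is fixed by σ.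 -/
open TensorProduct ExteriorAlgebra

section Lefschetz

variable {K M I : Type*} [Field K] [AddCommGroup M] [Module K M]

theorem ι_mul_mem_exteriorPower_succ (v : M) {n : ℕ} {x : ExteriorAlgebra K M}
    (hx : x ∈ ⋀[K]^n M) : ι K v * x ∈ ⋀[K]^(n + 1) M := by
  rw [exteriorPower, pow_succ']
  exact Submodule.mul_mem_mul (LinearMap.mem_range_self _ v) hx

/-- Induction on elements of an exterior power by left multiplication by vectors. -/
theorem exteriorPower_induction {P : ∀ n, ∀ x ∈ ⋀[K]^n M, Prop}
    (scalar : ∀ r : K, P 0 (algebraMap K _ r) (by simp))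
    (add : ∀ n x y hx hy, P n x hx → P n y hy → P n (x + y) (add_mem hx hy))
    (mul : ∀ n v x hx, P n x hx → P (n + 1) (ι K v * x) (ι_mul_mem_exteriorPower_succ v hx))
    {n : ℕ} {x : ExteriorAlgebra K M} (hx : x ∈ ⋀[K]^n M) : P n x hx :=
  Submodule.pow_induction_on_left' _ scalar (fun x y i hx hy => add i x y hx hy)
    (by rintro _ ⟨v, rfl⟩ i x hx h; exact mul i v x hx h) hx

open CliffordAlgebra in
theorem contractLeft_mem_exteriorPower (d : Module.Dual K M) {n : ℕ} {x : ExteriorAlgebra K M}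
    (hx : x ∈ ⋀[K]^(n + 1) M) : contractLeft (Q := 0) d x ∈ ⋀[K]^n M := by
  suffices h : ∀ m, ∀ x ∈ ⋀[K]^m M, (m = 0 → contractLeft (Q := 0) d x = 0) ∧
      ∀ n, m = n + 1 → contractLeft (Q := 0) d x ∈ ⋀[K]^n M from (h _ x hx).2 n rfl
  intro m x hx
  induction hx using exteriorPower_induction with
  | scalar r => simp
  | add n x y _ _ hx hy =>
    refine ⟨fun h => by rw [map_add, hx.1 h, hy.1 h, add_zero], fun n h => ?_⟩
    rw [map_add]
    exact add_mem (hx.2 n h) (hy.2 n h)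
  | mul n v x hx h =>
    refine ⟨by simp, fun k hk => ?_⟩
    obtain rfl : n = k := by omega
    rw [contractLeft_ι_mul]
    refine sub_mem (Submodule.smul_mem _ _ hx) ?_
    cases n with
    | zero => simp [h.1 rfl]
    | succ n => exact ι_mul_mem_exteriorPower_succ v (h.2 n rfl)

variable [Fintype I] (b : Module.Basis (I ⊕ I) K M)

/-- The bivector `∑ i, bᵢ ∧ b'ᵢ` attached to a basis `(bᵢ, b'ᵢ)`. -/
noncomputable def symplecticBivector : ExteriorAlgebra K M :=
  ∑ i, ι K (b (.inl i)) * ι K (b (.inr i))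

/-- Contraction with the bivector dual to `symplecticBivector b`. -/
noncomputable def dualLefschetz : ExteriorAlgebra K M →ₗ[K] ExteriorAlgebra K M :=
  ∑ i, CliffordAlgebra.contractLeft (Q := 0) (b.coord (.inr i)) ∘ₗ
    CliffordAlgebra.contractLeft (Q := 0) (b.coord (.inl i))

theorem symplecticBivector_mul_mem {n : ℕ} {x : ExteriorAlgebra K M} (hx : x ∈ ⋀[K]^n M) :
    symplecticBivector b * x ∈ ⋀[K]^(n + 2) M := by
  rw [symplecticBivector, Finset.sum_mul]
  refine sum_mem fun i _ => ?_
  rw [mul_assoc]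
  exact ι_mul_mem_exteriorPower_succ _ (ι_mul_mem_exteriorPower_succ _ hx)

theorem symplecticBivector_pow_mul_mem (r : ℕ) {n : ℕ} {x : ExteriorAlgebra K M}
    (hx : x ∈ ⋀[K]^n M) : symplecticBivector b ^ r * x ∈ ⋀[K]^(n + 2 * r) M := by
  induction r with
  | zero => simpa using hx
  | succ r ih =>
    rw [pow_succ', mul_assoc]
    exact symplecticBivector_mul_mem b ih

theorem dualLefschetz_mem {n : ℕ} {x : ExteriorAlgebra K M} (hx : x ∈ ⋀[K]^(n + 2) M) :
    dualLefschetz b x ∈ ⋀[K]^n M := by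
  rw [dualLefschetz, LinearMap.sum_apply]
  exact sum_mem fun i _ =>
    contractLeft_mem_exteriorPower _ (contractLeft_mem_exteriorPower _ hx)

open CliffordAlgebra in
theorem sum_ι_mul_contractLeft {J : Type*} [Fintype J] (b : Module.Basis J K M) {n : ℕ}
    {x : ExteriorAlgebra K M} (hx : x ∈ ⋀[K]^n M) :
    ∑ j, ExteriorAlgebra.ι K (b j) * contractLeft (Q := 0) (b.coord j) x = (n : K) • x := by
  induction hx using exteriorPower_induction with
  | scalar r =>
    have h (j) : contractLeft (Q := 0) (b.coord j) (algebraMap K (ExteriorAlgebra K M) r) = 0 :=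
      contractLeft_algebraMap _ _ r
    simp [h]
  | add n x y _ _ hx hy => simp only [map_add, mul_add, Finset.sum_add_distrib, hx, hy, smul_add]
  | mul n v x _ ih =>
    have h (j) : ExteriorAlgebra.ι K (b j) *
        contractLeft (Q := 0) (b.coord j) (ExteriorAlgebra.ι K v * x) =
        ExteriorAlgebra.ι K (b.repr v j • b j) * x + ExteriorAlgebra.ι K v *
          (ExteriorAlgebra.ι K (b j) * contractLeft (Q := 0) (b.coord j) x) := by
      have h1 := contractLeft_ι_mul (Q := 0) (b.coord j) v x
      have h2 := eq_neg_of_add_eq_zero_left (ExteriorAlgebra.ι_add_mul_swap (R := K) (b j) v)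
      rw [h1, mul_sub, ← mul_assoc, h2, neg_mul, sub_neg_eq_add, map_smul, mul_assoc,
        mul_smul_comm, smul_mul_assoc, Module.Basis.coord_apply]
    simp_rw [h]
    rw [Finset.sum_add_distrib, ← Finset.sum_mul, ← map_sum, b.sum_repr, ← Finset.mul_sum, ih,
      mul_smul_comm, Nat.cast_succ, add_smul, one_smul, add_comm]

open CliffordAlgebra in
theorem dualLefschetz_ι_mul (v : M) (x : ExteriorAlgebra K M) :
    dualLefschetz b (ExteriorAlgebra.ι K v * x) =
      ExteriorAlgebra.ι K v * dualLefschetz b x +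
        ∑ i, (b.repr v (.inl i) • contractLeft (Q := 0) (b.coord (.inr i)) x -
          b.repr v (.inr i) • contractLeft (Q := 0) (b.coord (.inl i)) x) := by
  have h (d : Module.Dual K M) (x) : contractLeft (Q := 0) d (ExteriorAlgebra.ι K v * x) =
      d v • x - ExteriorAlgebra.ι K v * contractLeft (Q := 0) d x := contractLeft_ι_mul d v x
  simp only [dualLefschetz, LinearMap.sum_apply, LinearMap.comp_apply, h, map_sub, map_smul,
    Finset.mul_sum, ← Finset.sum_add_distrib, Module.Basis.coord_apply]
  exact Finset.sum_congr rfl fun i _ => by abel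

open CliffordAlgebra in
/-- The `𝔰𝔩₂` commutation relation on the exterior algebra. -/
theorem dualLefschetz_symplecticBivector_mul {n : ℕ} {x : ExteriorAlgebra K M}
    (hx : x ∈ ⋀[K]^n M) :
    dualLefschetz b (symplecticBivector b * x) =
      symplecticBivector b * dualLefschetz b x + ((Fintype.card I : K) - n) • x := by
  classical
  have h (i : I) : dualLefschetz b
        (ExteriorAlgebra.ι K (b (.inl i)) * (ExteriorAlgebra.ι K (b (.inr i)) * x)) =
      ExteriorAlgebra.ι K (b (.inl i)) * (ExteriorAlgebra.ι K (b (.inr i)) * dualLefschetz b x) +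
      (x - (ExteriorAlgebra.ι K (b (.inl i)) * contractLeft (Q := 0) (b.coord (.inl i)) x +
        ExteriorAlgebra.ι K (b (.inr i)) * contractLeft (Q := 0) (b.coord (.inr i)) x)) := by
    have h1 : contractLeft (Q := 0) (b.coord (.inr i)) (ExteriorAlgebra.ι K (b (.inr i)) * x) =
        x - ExteriorAlgebra.ι K (b (.inr i)) * contractLeft (Q := 0) (b.coord (.inr i)) x := by
      have := contractLeft_ι_mul (Q := 0) (b.coord (.inr i)) (b (.inr i)) x
      simpa using this
    rw [dualLefschetz_ι_mul, dualLefschetz_ι_mul]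
    simp [Finsupp.single_apply, ite_smul, h1, mul_add]
    abel
  rw [sub_smul, ← sum_ι_mul_contractLeft b hx, Fintype.sum_sum_type]
  simp only [symplecticBivector, Finset.sum_mul, map_sum, mul_assoc, h, Finset.sum_add_distrib,
    Finset.sum_sub_distrib]
  simp [Nat.cast_smul_eq_nsmul]

theorem dualLefschetz_symplecticBivector_pow_mul (r : ℕ) {n : ℕ} {x : ExteriorAlgebra K M}
    (hx : x ∈ ⋀[K]^n M) :
    dualLefschetz b (symplecticBivector b ^ (r + 1) * x) =
      symplecticBivector b ^ (r + 1) * dualLefschetz b x +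
        ((r + 1 : K) * (Fintype.card I - n - r)) • (symplecticBivector b ^ r * x) := by
  induction r with
  | zero => simpa using dualLefschetz_symplecticBivector_mul b hx
  | succ r ih =>
    rw [pow_succ', mul_assoc, dualLefschetz_symplecticBivector_mul b
      (symplecticBivector_pow_mul_mem b (r + 1) hx), ih, mul_add, mul_smul_comm, ← mul_assoc,
      ← mul_assoc, ← pow_succ', ← pow_succ', add_assoc, ← add_smul]
    congr 2
    push_cast
    ring

theorem isNilpotent_symplecticBivector : IsNilpotent (symplecticBivector b) := by
  have hswap (v w : M) : ι K v * ι K w = -(ι K w * ι K v) :=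
    eq_neg_of_add_eq_zero_left (ι_add_mul_swap v w)
  have hcomm (u v w : M) : Commute (ι K u * ι K v) (ι K w) := by
    rw [Commute, SemiconjBy, mul_assoc, hswap v w, mul_neg, ← mul_assoc, hswap u w, neg_mul,
      neg_neg, mul_assoc]
  refine Commute.isNilpotent_sum (fun i _ => ⟨2, ?_⟩) fun i j _ _ =>
    (hcomm _ _ _).mul_right (hcomm _ _ _)
  rw [sq, ← mul_assoc, (hcomm _ _ _).eq, ← mul_assoc, ι_sq_zero, zero_mul, zero_mul]

/-- The surjectivity half of the hard Lefschetz theorem for the exterior algebra. -/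
theorem exists_symplecticBivector_mul_eq [CharZero K] {n : ℕ} (hn : Fintype.card I ≤ n + 1)
    {x : ExteriorAlgebra K M} (hx : x ∈ ⋀[K]^(n + 2) M) :
    ∃ y ∈ ⋀[K]^n M, symplecticBivector b * y = x := by
  obtain ⟨r, hr⟩ := isNilpotent_symplecticBivector b
  replace hr : symplecticBivector b ^ r * x = 0 := by rw [hr, zero_mul]
  induction r generalizing x with
  | zero => exact ⟨0, zero_mem _, by simpa using hr.symm⟩
  | succ r ih =>
    set c : K := (r + 1 : K) * (Fintype.card I - (n + 2 : ℕ) - r) with hc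
    have hc0 : c ≠ 0 := by
      refine mul_ne_zero (by exact_mod_cast r.succ_ne_zero) fun h => ?_
      have : (Fintype.card I : K) = (n + 2 + r : ℕ) := by
        push_cast at h ⊢
        linear_combination h
      have := Nat.cast_injective this
      omega
    have key := dualLefschetz_symplecticBivector_pow_mul b r hx
    rw [hr, map_zero, ← hc, pow_succ, mul_assoc, ← mul_smul_comm, ← mul_add] at key
    have hf := dualLefschetz_mem b hx
    obtain ⟨y, hy, hyx⟩ := ih (add_mem (symplecticBivector_mul_mem b hf)
      (Submodule.smul_mem _ c hx)) key.symm
    refine ⟨c⁻¹ • (y - dualLefschetz b x), Submodule.smul_mem _ _ (sub_mem hy hf), ?_⟩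
    rw [mul_smul_comm, mul_sub, hyx, add_sub_cancel_left, inv_smul_smul₀ hc0]

end Lefschetz

section Tensor

variable {K M I : Type*} [Field K] [AddCommGroup M] [Module K M]

theorem tmul_X_pow_mem {S : Subalgebra K (ExteriorAlgebra K M ⊗[K] Polynomial K)}
    (hS : ∀ v : M, ι K v ⊗ₜ[K] (Polynomial.X : Polynomial K) ∈ S) {n : ℕ}
    {x : ExteriorAlgebra K M} (hx : x ∈ ⋀[K]^n M) :
    x ⊗ₜ[K] (Polynomial.X ^ n : Polynomial K) ∈ S := by
  induction hx using exteriorPower_induction with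
  | scalar r => simpa using S.algebraMap_mem r
  | add n x y _ _ hx hy => simpa only [add_tmul] using add_mem hx hy
  | mul n v x _ ih =>
    rw [pow_succ', ← Algebra.TensorProduct.tmul_mul_tmul]
    exact mul_mem (hS v) ih

/-- Multiplying by powers of `X` of the right parity brings exterior powers into `S`: in low
degree directly, and in high degree by hard Lefschetz. -/
theorem tmul_X_pow_mem_of_even [CharZero K] [Fintype I] (b : Module.Basis (I ⊕ I) K M)
    {S : Subalgebra K (ExteriorAlgebra K M ⊗[K] Polynomial K)}
    (hS : ∀ v : M, ι K v ⊗ₜ[K] (Polynomial.X : Polynomial K) ∈ S)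
    (hX : (1 : ExteriorAlgebra K M) ⊗ₜ[K] (Polynomial.X ^ 2 : Polynomial K) ∈ S)
    (hw : symplecticBivector b ⊗ₜ[K] (1 : Polynomial K) ∈ S)
    {m : ℕ} (hm : Fintype.card I ≤ m + 1) {n : ℕ} (hnm : Even (n + m))
    {x : ExteriorAlgebra K M} (hx : x ∈ ⋀[K]^n M) :
    x ⊗ₜ[K] (Polynomial.X ^ m : Polynomial K) ∈ S := by
  induction n using Nat.strong_induction_on generalizing x with
  | _ n ih =>
    rcases le_or_gt n m with h | h
    · obtain ⟨t, rfl⟩ : ∃ t, m = n + 2 * t := ⟨(m - n) / 2, by grind⟩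
      have := mul_mem (tmul_X_pow_mem hS hx) (pow_mem hX t)
      simpa [Algebra.TensorProduct.tmul_pow, ← pow_mul, ← pow_add] using this
    · obtain ⟨k, rfl⟩ : ∃ k, n = k + 2 := ⟨n - 2, by grind⟩
      obtain ⟨y, hy, rfl⟩ := exists_symplecticBivector_mul_eq b (by grind) hx
      simpa using mul_mem hw (ih k (by omega) (by grind) hy)

/-- The grading involution acts on a bihomogeneous element by the sign of its total degree. -/
theorem map_tmul_X_pow_of_mem_exteriorPower
    (σ : (ExteriorAlgebra K M ⊗[K] Polynomial K) →ₐ[K] (ExteriorAlgebra K M ⊗[K] Polynomial K))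
    (hσι : ∀ v : M, σ (ι K v ⊗ₜ[K] 1) = (-1 : K) • ι K v ⊗ₜ[K] 1)
    (hσX : σ (1 ⊗ₜ[K] Polynomial.X) = (-1 : K) • 1 ⊗ₜ[K] Polynomial.X)
    {n : ℕ} {x : ExteriorAlgebra K M} (hx : x ∈ ⋀[K]^n M) (m : ℕ) :
    σ (x ⊗ₜ[K] (Polynomial.X ^ m)) = (-1 : K) ^ (n + m) • x ⊗ₜ[K] (Polynomial.X ^ m) := by
  induction hx using exteriorPower_induction with
  | scalar r =>
    have h : algebraMap K (ExteriorAlgebra K M) r ⊗ₜ[K] (Polynomial.X ^ m : Polynomial K) =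
        r • (1 ⊗ₜ[K] Polynomial.X) ^ m := by
      rw [Algebra.TensorProduct.tmul_pow, one_pow, smul_tmul', Algebra.algebraMap_eq_smul_one]
    rw [h, map_smul, map_pow, hσX, smul_pow, zero_add, smul_comm]
  | add n x y _ _ hx hy => rw [add_tmul, map_add, hx, hy, smul_add]
  | mul n v x _ ih =>
    have h : (ι K v * x) ⊗ₜ[K] (Polynomial.X ^ m : Polynomial K) =
        ι K v ⊗ₜ[K] 1 * x ⊗ₜ[K] (Polynomial.X ^ m) := by simp
    rw [h, map_mul, hσι, ih, smul_mul_smul_comm, ← pow_succ', add_right_comm]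

end Tensor

/-- Let `A = ⋀(ℂ^{2g}) ⊗_ℂ ℂ[u]`, let `σ` be the ℂ-algebra automorphism of `A` acting
as `−1` on each generator `dᵢ` and on `u`, let `B` be the subalgebra generated by
`w = Σ_{i=1}^{g} dᵢ d_{g+i}`, `u²` and the `u·dᵢ`, and let `D = A·u^{g−1}`. Then
`B ∩ D = {x ∈ D : σ(x) = x}`: an element divisible by `u^{g−1}` lies in `B` iff it is
fixed by `σ`. -/
theorem image_inter_divisible_eq_invariants (g : ℕ) (hg : 2 ≤ g)
    (σ : (ExteriorAlgebra ℂ (Fin (2 * g) → ℂ) ⊗[ℂ] Polynomial ℂ) ≃ₐ[ℂ]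
         (ExteriorAlgebra ℂ (Fin (2 * g) → ℂ) ⊗[ℂ] Polynomial ℂ))
    (hσd : ∀ i : Fin (2 * g),
      σ (ι ℂ (Pi.single i (1 : ℂ)) ⊗ₜ[ℂ] (1 : Polynomial ℂ)) =
        -(ι ℂ (Pi.single i (1 : ℂ)) ⊗ₜ[ℂ] (1 : Polynomial ℂ)))
    (hσu : σ ((1 : ExteriorAlgebra ℂ (Fin (2 * g) → ℂ)) ⊗ₜ[ℂ] Polynomial.X) =
        -((1 : ExteriorAlgebra ℂ (Fin (2 * g) → ℂ)) ⊗ₜ[ℂ] Polynomial.X)) :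
    let A := ExteriorAlgebra ℂ (Fin (2 * g) → ℂ) ⊗[ℂ] Polynomial ℂ
    let w : A := (∑ i : Fin g,
        ι ℂ (Pi.single (⟨i.1, by omega⟩ : Fin (2 * g)) (1 : ℂ)) *
          ι ℂ (Pi.single (⟨g + i.1, by omega⟩ : Fin (2 * g)) (1 : ℂ))) ⊗ₜ[ℂ]
        (1 : Polynomial ℂ)
    let B := Algebra.adjoin ℂ
        ({w, (1 : ExteriorAlgebra ℂ (Fin (2 * g) → ℂ)) ⊗ₜ[ℂ] (Polynomial.X ^ 2)} ∪
          Set.range fun i : Fin (2 * g) =>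
            ι ℂ (Pi.single i (1 : ℂ)) ⊗ₜ[ℂ] (Polynomial.X : Polynomial ℂ))
    let D : Set A := {x | ∃ y : A,
        x = y * ((1 : ExteriorAlgebra ℂ (Fin (2 * g) → ℂ)) ⊗ₜ[ℂ] (Polynomial.X ^ (g - 1)))}
    (B : Set A) ∩ D = {x ∈ D | σ x = x} := by
  intro A w B D
  let e : Fin g ⊕ Fin g ≃ Fin (2 * g) := finSumFinEquiv.trans (finCongr (two_mul g).symm)
  set b := (Pi.basisFun ℂ (Fin (2 * g))).reindex e.symm with hb
  have hwb : w = symplecticBivector b ⊗ₜ[ℂ] (1 : Polynomial ℂ) := by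
    simp only [w, symplecticBivector, hb, Module.Basis.reindex_apply, Equiv.symm_symm,
      Pi.basisFun_apply]
    rfl
  have hspan {P : (Fin (2 * g) → ℂ) → Prop} (h0 : ∀ i, P (Pi.single i 1))
      (hadd : ∀ x y, P x → P y → P (x + y)) (hsmul : ∀ (c : ℂ) x, P x → P (c • x)) (v) : P v := by
    have hz : P 0 := by simpa using hsmul 0 _ (h0 ⟨0, by omega⟩)
    rw [← (Pi.basisFun ℂ (Fin (2 * g))).sum_repr v]
    exact Finset.sum_induction _ P hadd hz fun i _ => hsmul _ _ (by simpa using h0 i)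
  have hσι (v : Fin (2 * g) → ℂ) :
      σ (ι ℂ v ⊗ₜ[ℂ] (1 : Polynomial ℂ)) = -(ι ℂ v ⊗ₜ[ℂ] (1 : Polynomial ℂ)) := by
    induction v using hspan with
    | h0 i => exact hσd i
    | hadd x y hx hy => rw [map_add, add_tmul, map_add, hx, hy, neg_add]
    | hsmul c x hx => rw [map_smul, ← smul_tmul', map_smul, hx, smul_neg]
  have hσmul {k : ℕ} {x} (hx : x ∈ ⋀[ℂ]^k (Fin (2 * g) → ℂ)) (n : ℕ) :
      σ (x ⊗ₜ[ℂ] (Polynomial.X ^ n)) = (-1 : ℂ) ^ (k + n) • x ⊗ₜ[ℂ] (Polynomial.X ^ n) :=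
    map_tmul_X_pow_of_mem_exteriorPower (σ : _ →ₐ[ℂ] _)
      (fun v => (hσι v).trans (neg_one_smul ℂ _).symm) (hσu.trans (neg_one_smul ℂ _).symm) hx n
  have hBι (v : Fin (2 * g) → ℂ) : ι ℂ v ⊗ₜ[ℂ] (Polynomial.X : Polynomial ℂ) ∈ B := by
    induction v using hspan with
    | h0 i => exact Algebra.subset_adjoin (.inr ⟨i, rfl⟩)
    | hadd x y hx hy => rw [map_add, add_tmul]; exact add_mem hx hy
    | hsmul c x hx => rw [map_smul, ← smul_tmul']; exact B.smul_mem hx c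
  have hBX : (1 : ExteriorAlgebra ℂ (Fin (2 * g) → ℂ)) ⊗ₜ[ℂ] (Polynomial.X ^ 2) ∈ B :=
    Algebra.subset_adjoin (.inl (.inr rfl))
  have hBw : symplecticBivector b ⊗ₜ[ℂ] (1 : Polynomial ℂ) ∈ B :=
    hwb ▸ Algebra.subset_adjoin (.inl (.inl rfl))
  have hBσ : B ≤ AlgHom.equalizer (σ : _ →ₐ[ℂ] _) (AlgHom.id ℂ _) := by
    refine Algebra.adjoin_le ?_
    rintro _ ((rfl | rfl) | ⟨i, rfl⟩)
    · have h : symplecticBivector b ∈ ⋀[ℂ]^2 (Fin (2 * g) → ℂ) := by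
        simpa using symplecticBivector_mul_mem b (n := 0) (x := 1) (by simp)
      simpa [hwb] using hσmul h 0
    · simpa using hσmul (k := 0) (x := 1) (by simp) 2
    · have h : ι ℂ (Pi.single i (1 : ℂ)) ∈ ⋀[ℂ]^1 (Fin (2 * g) → ℂ) := by simp
      simpa using hσmul h 1
  have hsymm (y : A) : y * 1 ⊗ₜ[ℂ] (Polynomial.X ^ (g - 1)) +
      σ (y * 1 ⊗ₜ[ℂ] (Polynomial.X ^ (g - 1))) ∈ B := by
    induction y using TensorProduct.induction_on with
    | zero => simp
    | add x y hx hy =>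
      rw [add_mul, map_add, add_add_add_comm]
      exact add_mem hx hy
    | tmul a p =>
      induction p using Polynomial.induction_on' with
      | add p q hp hq =>
        rw [tmul_add, add_mul, map_add, add_add_add_comm]
        exact add_mem hp hq
      | monomial m c =>
        induction a using DirectSum.Decomposition.inductionOn
          (fun k : ℕ => ⋀[ℂ]^k (Fin (2 * g) → ℂ)) with
        | zero => simp
        | add x y hx hy =>
          rw [add_tmul, add_mul, map_add, add_add_add_comm]
          exact add_mem hx hy
        | @homogeneous k x =>
          have h : (x : ExteriorAlgebra ℂ (Fin (2 * g) → ℂ)) ⊗ₜ[ℂ] (Polynomial.monomial m c) *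
              1 ⊗ₜ[ℂ] (Polynomial.X ^ (g - 1)) =
              c • (x : ExteriorAlgebra ℂ (Fin (2 * g) → ℂ)) ⊗ₜ[ℂ]
                (Polynomial.X ^ (m + (g - 1))) := by
            rw [Algebra.TensorProduct.tmul_mul_tmul, mul_one, ← tmul_smul, pow_add,
              ← smul_mul_assoc, Polynomial.smul_X_eq_monomial]
          rw [h, map_smul, hσmul x.2, ← smul_add]
          refine B.smul_mem ?_ c
          rcases Nat.even_or_odd (k + (m + (g - 1))) with hk | hk
          · have hx := tmul_X_pow_mem_of_even b hBι hBX hBw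
              (by rw [Fintype.card_fin]; omega) hk x.2
            rw [hk.neg_one_pow, one_smul]
            exact add_mem hx hx
          · rw [hk.neg_one_pow]
            convert zero_mem B
            module
  ext x
  constructor
  · rintro ⟨hxB, hxD⟩
    exact ⟨hxD, hBσ hxB⟩
  · rintro ⟨⟨y, hy⟩, hx⟩
    refine ⟨?_, y, hy⟩
    have h := hsymm y
    rw [← hy, hx, ← two_smul ℂ] at h
    simpa using B.smul_mem h (2⁻¹ : ℂ)
end
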